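/- arXiv:1710.09652 — 2 statements merged into one kernel-verified Lean document; each statement's English description precedes it below -/
import Mathlib

section
/- Let r ≥ 2 be an integer and let G be an 𝓕_{2r+1}-free coloured graph on n vertices with δ(G) > ((6r−8)/(3r−1))·n. Then there is a homomorphism from G to RK_r; explicitly, there is a partition V(G) = W_1 ∪ … ∪ W_r into r classes such that w(x,y) = 0 for any two distinct vertices x, y lying in the same class. -/
/-- A coloured graph structure on a weight function: symmetric, `{0,1,2}`-valued,
vanishing on the diagonal. -/
def IsColoured {V : Type*} (w : V → V → ℕ) : Prop :=
  (∀ x y, w x y = w y x) ∧ (∀ x y, w x y ≤ 2) ∧ (∀ x, w x x = 0)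

/-- The coloured graph with weight function `f` on `Fin m` is a subgraph of `(V, w)`. -/
def HasSub {V : Type*} (w : V → V → ℕ) {m : ℕ} (f : Fin m → Fin m → ℕ) : Prop :=
  ∃ φ : Fin m → V, Function.Injective φ ∧ ∀ x y, f x y ≤ w (φ x) (φ y)

/-- The red clique `RK_m`: every edge has weight `2`. -/
def RK (m : ℕ) : Fin m → Fin m → ℕ := fun x y => if x = y then 0 else 2

/-- The blue clique `BK_m`: every edge has weight `1`. -/
def BK (m : ℕ) : Fin m → Fin m → ℕ := fun x y => if x = y then 0 else 1

/-- The coloured graph `G_{t,i}` of order `t - i`: a red clique `RK_i` (the first `i`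
vertices) and a blue clique `BK_{t-2i}`, joined by edges of weight `1`. -/
def Gt (t i : ℕ) : Fin (t - i) → Fin (t - i) → ℕ :=
  fun x y => if x = y then 0 else if x.val < i ∧ y.val < i then 2 else 1

/-- `(V, w)` is `𝓕_t`-free, where `𝓕_t = {G_{t,i} : 1 ≤ i ≤ t/2}`. -/
def FamFree {V : Type*} (w : V → V → ℕ) (t : ℕ) : Prop :=
  ∀ i, 1 ≤ i → 2 * i ≤ t → ¬ HasSub w (Gt t i)

section IndependentSets

variable {V : Type*} [DecidableEq V] (G : SimpleGraph V) [DecidableRel G.Adj]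

/-- In a set inducing a graph of maximum degree at most one, some independent set contains all
isolated vertices and half of the others. -/
lemma exists_indepSet_of_induced_degree_le_one (S : Finset V)
    (hS : ∀ x ∈ S, ∀ y ∈ S, ∀ z ∈ S, G.Adj x y → G.Adj x z → y = z) :
    ∃ I ⊆ S, G.IsIndepSet I ∧ S.card + {x ∈ S | ∀ y ∈ S, ¬ G.Adj x y}.card ≤ 2 * I.card := by
  classical
  obtain ⟨I, hI, hmax⟩ := Finset.exists_max_image
    (S.powerset.filter fun I : Finset V => G.IsIndepSet (I : Set V))
    Finset.card ⟨∅, by simp [SimpleGraph.IsIndepSet]⟩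
  simp only [Finset.mem_filter, Finset.mem_powerset] at hI hmax
  refine ⟨I, hI.1, hI.2, ?_⟩
  set L : Finset V := {x ∈ S | ∀ y ∈ S, ¬ G.Adj x y} with hL
  have hnbr : ∀ x ∈ S, x ∉ I → ∃ y ∈ I, G.Adj x y := by
    intro x hx hxI
    by_contra! hno
    have hind : G.IsIndepSet (insert x I : Finset V) := by
      intro a ha b hb hab
      simp only [Finset.coe_insert, Set.mem_insert_iff, Finset.mem_coe] at ha hb
      rcases ha with rfl | ha <;> rcases hb with rfl | hb
      · exact absurd rfl hab
      · exact hno b hb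
      · exact fun h => hno a ha h.symm
      · exact hI.2 ha hb hab
    have := hmax _ ⟨Finset.insert_subset hx hI.1, hind⟩
    rw [Finset.card_insert_of_notMem hxI] at this
    omega
  have hLI : L ⊆ I := by
    intro x hx
    by_contra hxI
    obtain ⟨hxS, hiso⟩ := Finset.mem_filter.1 hx
    obtain ⟨y, hy, hxy⟩ := hnbr x hxS hxI
    exact hiso y (hI.1 hy) hxy
  choose! f hfI hfadj using hnbr
  have hle : (S \ I).card ≤ (I \ L).card := by
    refine Finset.card_le_card_of_injOn f ?_ ?_
    · intro x hx
      simp only [Finset.coe_sdiff, Set.mem_sdiff, Finset.mem_coe] at hx ⊢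
      refine ⟨hfI x hx.1 hx.2, fun h => ?_⟩
      exact (Finset.mem_filter.1 h).2 x hx.1 (hfadj x hx.1 hx.2).symm
    · intro x hx y hy hxy
      simp only [Finset.coe_sdiff, Set.mem_sdiff, Finset.mem_coe] at hx hy
      refine hS (f x) (hI.1 (hfI x hx.1 hx.2)) x hx.1 y hy.1 (hfadj x hx.1 hx.2).symm ?_
      rw [hxy]
      exact (hfadj y hy.1 hy.2).symm
  have h1 := Finset.card_sdiff_add_card_eq_card hI.1
  have h2 := Finset.card_sdiff_add_card_eq_card hLI
  omega

/-- If some vertex has degree at least two inside `K`, then `K` has an independent set larger by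
one than the number of isolated vertices plus half of the number of vertices of degree one. -/
lemma exists_large_indepSet (K : Finset V) :
    ∃ I ⊆ K, G.IsIndepSet I ∧
      2 * {x ∈ K | {y ∈ K | G.Adj x y}.card = 0}.card
        + {x ∈ K | {y ∈ K | G.Adj x y}.card = 1}.card
        + (if ∃ v ∈ K, 2 ≤ {y ∈ K | G.Adj v y}.card then 2 else 0) ≤ 2 * I.card := by
  set d : V → ℕ := fun x => {y ∈ K | G.Adj x y}.card with hd
  change ∃ I ⊆ K, G.IsIndepSet I ∧ 2 * {x ∈ K | d x = 0}.card + {x ∈ K | d x = 1}.card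
    + (if ∃ v ∈ K, 2 ≤ d v then 2 else 0) ≤ 2 * I.card
  have huniq : ∀ x ∈ K, d x ≤ 1 → ∀ y ∈ K, ∀ z ∈ K, G.Adj x y → G.Adj x z → y = z := by
    intro x _ hdx y hy z hz hxy hxz
    exact Finset.card_le_one.1 hdx y (by simp [hy, hxy]) z (by simp [hz, hxz])
  set S : Finset V := {x ∈ K | d x ≤ 1} with hSdef
  have hSK : S ⊆ K := Finset.filter_subset _ _
  obtain ⟨I, hIS, hI, hcard⟩ := exists_indepSet_of_induced_degree_le_one G S (by
    intro x hx y hy z hz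
    obtain ⟨hxK, hdx⟩ := Finset.mem_filter.1 hx
    exact huniq x hxK hdx y (hSK hy) z (hSK hz))
  set N₀ : Finset V := {x ∈ K | d x = 0} with hN₀
  set N₁ : Finset V := {x ∈ K | d x = 1} with hN₁
  set L : Finset V := {x ∈ S | ∀ y ∈ S, ¬ G.Adj x y} with hL
  have hSc : S.card = N₀.card + N₁.card := by
    rw [← Finset.card_union_of_disjoint]
    · congr 1
      ext x
      simp only [hSdef, hN₀, hN₁, Finset.mem_filter, Finset.mem_union, ← and_or_left]
      refine and_congr_right fun _ => ?_
      omega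
    · refine Finset.disjoint_filter.2 fun x _ h0 h1 => ?_
      omega
  have hnoadj : ∀ x ∈ N₀, ∀ y ∈ K, ¬ G.Adj x y := by
    intro x hx y hy hxy
    have h0 := (Finset.mem_filter.1 hx).2
    simp only [hd, Finset.card_eq_zero] at h0
    exact Finset.eq_empty_iff_forall_notMem.1 h0 y (by simp [hy, hxy])
  have hN₀L : N₀ ⊆ L := by
    intro x hx
    have h := Finset.mem_filter.1 hx
    refine Finset.mem_filter.2 ⟨Finset.mem_filter.2 ⟨h.1, by omega⟩, fun y hy => ?_⟩
    exact hnoadj x hx y (hSK hy)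
  have hN₀Lc := Finset.card_le_card hN₀L
  split_ifs with hv
  swap
  · exact ⟨I, hIS.trans hSK, hI, by omega⟩
  have hleaf : ∀ u ∈ K, 2 ≤ d u → ∀ x ∈ S, G.Adj u x → x ∈ L \ N₀ := by
    intro u hu hdu x hx hux
    have hx' := Finset.mem_filter.1 hx
    refine Finset.mem_sdiff.2 ⟨Finset.mem_filter.2 ⟨hx, fun y hy hxy => ?_⟩, fun h0 => ?_⟩
    · have := huniq x hx'.1 hx'.2 y (hSK hy) u hu hxy hux.symm
      subst this
      have := (Finset.mem_filter.1 hy).2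
      omega
    · exact hnoadj x h0 u hu hux.symm
  have htwo : ∀ x ∈ L \ N₀, ∀ y ∈ L \ N₀, x ≠ y → ∃ I ⊆ K, G.IsIndepSet I ∧
      2 * N₀.card + N₁.card + 2 ≤ 2 * I.card := by
    intro x hx y hy hxy
    refine ⟨I, hIS.trans hSK, hI, ?_⟩
    have h1 : 1 < (L \ N₀).card := Finset.one_lt_card.2 ⟨x, hx, y, hy, hxy⟩
    have h2 := Finset.card_sdiff_add_card_eq_card hN₀L
    omega
  have hfree : ∀ u ∈ K, 2 ≤ d u → (∀ x ∈ S, ¬ G.Adj u x) → ∃ I ⊆ K, G.IsIndepSet I ∧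
      2 * N₀.card + N₁.card + 2 ≤ 2 * I.card := by
    intro u hu hdu hux
    have huI : u ∉ I := by
      intro h
      have := (Finset.mem_filter.1 (hIS h)).2
      omega
    refine ⟨insert u I, Finset.insert_subset hu (hIS.trans hSK), ?_, ?_⟩
    · intro a ha b hb hab
      simp only [Finset.coe_insert, Set.mem_insert_iff, Finset.mem_coe] at ha hb
      rcases ha with rfl | ha <;> rcases hb with rfl | hb
      · exact absurd rfl hab
      · exact hux b (hIS hb)
      · exact fun h => hux a (hIS ha) h.symm
      · exact hI ha hb hab
    · rw [Finset.card_insert_of_notMem huI]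
      omega
  obtain ⟨v, hvK, hdv⟩ := hv
  by_cases hvS : ∀ x ∈ S, ¬ G.Adj v x
  · exact hfree v hvK hdv hvS
  push Not at hvS
  obtain ⟨x, hxS, hvx⟩ := hvS
  obtain ⟨y, hy, hyx⟩ := Finset.exists_mem_ne (Nat.lt_of_succ_le hdv) x
  obtain ⟨hyK, hvy⟩ := Finset.mem_filter.1 hy
  by_cases hyS : y ∈ S
  · exact htwo y (hleaf v hvK hdv y hyS hvy) x (hleaf v hvK hdv x hxS hvx) hyx
  have hdy : 2 ≤ d y := by
    by_contra h
    exact hyS (Finset.mem_filter.2 ⟨hyK, by omega⟩)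
  by_cases hyfree : ∀ z ∈ S, ¬ G.Adj y z
  · exact hfree y hyK hdy hyfree
  push Not at hyfree
  obtain ⟨z, hzS, hyz⟩ := hyfree
  refine htwo z (hleaf y hyK hdy z hzS hyz) x (hleaf v hvK hdv x hxS hvx) ?_
  rintro rfl
  have hz := Finset.mem_filter.1 hzS
  have := huniq z hz.1 hz.2 y hyK v hvK hyz.symm hvx.symm
  subst this
  exact G.irrefl hvy

end IndependentSets

section Coloured

variable {V : Type*} {w : V → V → ℕ}

/-- The graph of edges of nonzero weight. -/
def supportGraph (hG : IsColoured w) : SimpleGraph V where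
  Adj x y := w x y ≠ 0
  symm := ⟨fun x y h => by rwa [hG.1 y x]⟩
  loopless := ⟨fun x h => h (hG.2.2 x)⟩

/-- The graph of edges of weight one. -/
def blueGraph (hG : IsColoured w) : SimpleGraph V where
  Adj x y := w x y = 1
  symm := ⟨fun x y h => by rwa [hG.1 y x]⟩
  loopless := ⟨fun x h => by simp [hG.2.2 x] at h⟩

/-- A clique `K` containing a red clique `I` gives a copy of `Gt t i` as soon as `i ≤ |I|` and
`t - i ≤ |K|`. -/
lemma hasSub_Gt_of_clique [DecidableEq V] {K I : Finset V} (hIK : I ⊆ K)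
    (hK : ∀ x ∈ K, ∀ y ∈ K, x ≠ y → 1 ≤ w x y) (hI : ∀ x ∈ I, ∀ y ∈ I, x ≠ y → 2 ≤ w x y)
    {t i : ℕ} (hi : i ≤ I.card) (hti : t - i ≤ K.card) (hit : i ≤ t - i) :
    HasSub w (Gt t i) := by
  obtain ⟨I', hI', hI'c⟩ := Finset.exists_subset_card_eq hi
  have hsub : I' ⊆ K := hI'.trans hIK
  obtain ⟨J, hI'J, hJK, hJc⟩ := Finset.exists_subsuperset_card_eq hsub (hI'c.trans_le hit) hti
  have hdiff : (J \ I').card = t - i - i := by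
    rw [Finset.card_sdiff_of_subset hI'J, hJc, hI'c]
  let e₁ := (I'.equivFinOfCardEq hI'c).symm
  let e₂ := ((J \ I').equivFinOfCardEq hdiff).symm
  let φ : Fin (t - i) → V := fun x =>
    if h : x.val < i then (e₁ ⟨x, h⟩ : V) else (e₂ ⟨x - i, by omega⟩ : V)
  have hφ₁ : ∀ x : Fin (t - i), x.val < i → φ x ∈ I' := by
    intro x h
    simp only [φ, h, dif_pos]
    exact (e₁ _).2
  have hφ₂ : ∀ x : Fin (t - i), ¬ x.val < i → φ x ∈ J \ I' := by
    intro x h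
    simp only [φ, h, dif_neg, not_false_eq_true]
    exact (e₂ _).2
  have hφJ : ∀ x, φ x ∈ K := by
    intro x
    by_cases h : x.val < i
    · exact hsub (hφ₁ x h)
    · exact hJK (Finset.sdiff_subset (hφ₂ x h))
  have hinj : Function.Injective φ := by
    intro x y hxy
    by_cases hx : x.val < i <;> by_cases hy : y.val < i
    · simp only [φ, hx, hy, dif_pos] at hxy
      have := e₁.injective (Subtype.ext hxy)
      simpa [Fin.ext_iff] using this
    · have h1 := hφ₁ x hx
      rw [hxy] at h1
      exact absurd h1 (Finset.mem_sdiff.1 (hφ₂ y hy)).2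
    · have h1 := hφ₁ y hy
      rw [← hxy] at h1
      exact absurd h1 (Finset.mem_sdiff.1 (hφ₂ x hx)).2
    · simp only [φ, hx, hy, dif_neg, not_false_eq_true] at hxy
      have := e₂.injective (Subtype.ext hxy)
      simp only [Fin.mk.injEq] at this
      apply Fin.ext
      omega
  refine ⟨φ, hinj, fun x y => ?_⟩
  unfold Gt
  split_ifs with hxy h
  · exact Nat.zero_le _
  · exact hI _ (hI' (hφ₁ x h.1)) _ (hI' (hφ₁ y h.2)) (hinj.ne hxy)
  · exact hK _ (hφJ x) _ (hφJ y) (hinj.ne hxy)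

/-- In an `𝓕_{2r+1}`-free coloured graph, a clique of order at least `r + 1` and a nonempty red
clique inside it have at most `2r` vertices counted together. -/
lemma FamFree.card_add_card_le [DecidableEq V] {r : ℕ} (hfree : FamFree w (2 * r + 1))
    {K I : Finset V} (hIK : I ⊆ K) (hK : ∀ x ∈ K, ∀ y ∈ K, x ≠ y → 1 ≤ w x y)
    (hI : ∀ x ∈ I, ∀ y ∈ I, x ≠ y → 2 ≤ w x y) (hr : 1 ≤ r) (hKr : r + 1 ≤ K.card)
    (hI₀ : 1 ≤ I.card) : K.card + I.card ≤ 2 * r := by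
  by_contra! h
  refine hfree (max 1 (2 * r + 1 - K.card)) (le_max_left _ _) (by omega) ?_
  exact hasSub_Gt_of_clique hIK hK hI (by omega) (by omega) (by omega)

/-- A maximum clique of maximum total weight: every vertex misses a vertex of the clique, and
a vertex missing only `a` has at least as much deficiency on the rest of the clique as `a`. -/
lemma exists_extremal_clique [Fintype V] [DecidableEq V] (hG : IsColoured w) {s : Finset V}
    (hs : ∀ x ∈ s, ∀ y ∈ s, x ≠ y → 1 ≤ w x y) :
    ∃ K : Finset V, s.card ≤ K.card ∧ (∀ x ∈ K, ∀ y ∈ K, x ≠ y → 1 ≤ w x y) ∧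
      ∀ v, ∃ a ∈ K, w v a = 0 ∧ ((∃ b ∈ K.erase a, w v b = 0) ∨
        ∑ y ∈ K.erase a, w v y ≤ ∑ y ∈ K.erase a, w a y) := by
  let IsCl : Finset V → Prop := fun K => ∀ x ∈ K, ∀ y ∈ K, x ≠ y → 1 ≤ w x y
  classical
  obtain ⟨K₀, hK₀, hmax₀⟩ := Finset.exists_max_image {K : Finset V | IsCl K} Finset.card
    ⟨s, by simpa [IsCl] using hs⟩
  obtain ⟨K, hK, hmax⟩ := Finset.exists_max_image
    {K : Finset V | IsCl K ∧ K.card = K₀.card} (fun K => ∑ x ∈ K, ∑ y ∈ K, w x y)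
    ⟨K₀, by simpa using hK₀⟩
  simp only [Finset.mem_filter, Finset.mem_univ, true_and] at hK₀ hmax₀ hK hmax
  have hinsert : ∀ (L : Finset V) (v : V), IsCl L → (∀ y ∈ L, w v y ≠ 0) → IsCl (insert v L) := by
    intro L v hL hv x hx y hy hxy
    rcases Finset.mem_insert.1 hx with rfl | hxL <;> rcases Finset.mem_insert.1 hy with rfl | hyL
    · exact absurd rfl hxy
    · exact Nat.one_le_iff_ne_zero.2 (hv y hyL)
    · rw [hG.1]
      exact Nat.one_le_iff_ne_zero.2 (hv x hxL)
    · exact hL x hxL y hyL hxy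
  have hsum : ∀ (L : Finset V) (v : V), v ∉ L → ∑ x ∈ insert v L, ∑ y ∈ insert v L, w x y
      = ∑ x ∈ L, ∑ y ∈ L, w x y + 2 * ∑ y ∈ L, w v y := by
    intro L v hv
    have : ∑ x ∈ L, w x v = ∑ x ∈ L, w v x := Finset.sum_congr rfl fun x _ => hG.1 x v
    simp only [Finset.sum_insert hv, hG.2.2, Finset.sum_add_distrib, this]
    ring
  refine ⟨K, hK.2 ▸ hmax₀ s hs, hK.1, fun v => ?_⟩
  obtain ⟨a, haK, hva⟩ : ∃ a ∈ K, w v a = 0 := by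
    by_contra! hno
    have hvK : v ∉ K := fun h => hno v h (hG.2.2 v)
    have := hmax₀ _ (hinsert K v hK.1 hno)
    rw [Finset.card_insert_of_notMem hvK] at this
    omega
  refine ⟨a, haK, hva, ?_⟩
  by_cases hb : ∃ b ∈ K.erase a, w v b = 0
  · exact Or.inl hb
  push Not at hb
  right
  have hvE : v ∉ K.erase a := fun h => hb v h (hG.2.2 v)
  have hErase : IsCl (K.erase a) := fun x hx y hy =>
    hK.1 x (Finset.mem_of_mem_erase hx) y (Finset.mem_of_mem_erase hy)
  have hle := hmax (insert v (K.erase a)) ⟨hinsert _ v hErase hb, by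
    rw [Finset.card_insert_of_notMem hvE, Finset.card_erase_add_one haK, hK.2]⟩
  have h1 := hsum (K.erase a) v hvE
  have h2 := hsum (K.erase a) a (Finset.notMem_erase a K)
  rw [Finset.insert_erase haK] at h2
  omega

/-- Weighted degree counting: a nonnegative weighting of `K` under which every vertex has
deficiency at least one has large total weight. -/
lemma lt_sum_of_deficiency [Fintype V] {D : ℝ}
    (hdeg : ∀ x : V, (2 - D) * (Fintype.card V : ℝ) < ∑ y : V, (w x y : ℝ))
    (hsymm : ∀ x y, w x y = w y x) {K : Finset V} (hK : K.Nonempty) {l : V → ℝ}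
    (hl : ∀ x, 0 < l x) (hdef : ∀ v, 1 ≤ ∑ x ∈ K, l x * (2 - (w v x : ℝ))) :
    1 < D * ∑ x ∈ K, l x := by
  have hn : (0 : ℝ) < Fintype.card V := by
    obtain ⟨x, _⟩ := hK
    exact_mod_cast Fintype.card_pos_iff.2 ⟨x⟩
  have h1 : (Fintype.card V : ℝ) ≤ ∑ v : V, ∑ x ∈ K, l x * (2 - (w v x : ℝ)) := by
    calc (Fintype.card V : ℝ) = ∑ v : V, (1 : ℝ) := by simp
      _ ≤ _ := Finset.sum_le_sum fun v _ => hdef v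
  have h2 : ∑ v : V, ∑ x ∈ K, l x * (2 - (w v x : ℝ))
      < ∑ x ∈ K, l x * (D * (Fintype.card V : ℝ)) := by
    rw [Finset.sum_comm]
    refine Finset.sum_lt_sum_of_nonempty hK fun x _ => ?_
    rw [← Finset.mul_sum]
    refine mul_lt_mul_of_pos_left ?_ (hl x)
    have h := hdeg x
    have hs : ∑ v : V, (w v x : ℝ) = ∑ v : V, (w x v : ℝ) :=
      Finset.sum_congr rfl fun v _ => by rw [hsymm]
    simp only [Finset.sum_sub_distrib, hs, Finset.sum_const, Finset.card_univ, nsmul_eq_mul]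
    linarith
  rw [← Finset.sum_mul] at h2
  nlinarith

/-- Sums of a function of the degree only, split according to degree zero, one, or at least two. -/
lemma sum_three_values (K : Finset V) (d : V → ℕ) (a b c : ℝ) :
    ∑ x ∈ K, (if d x = 0 then a else if d x = 1 then b else c)
      = a * {x ∈ K | d x = 0}.card + b * {x ∈ K | d x = 1}.card + c * {x ∈ K | 2 ≤ d x}.card := by
  have h : ∀ x ∈ K, (if d x = 0 then a else if d x = 1 then b else c)
      = (if d x = 0 then a else 0) + (if d x = 1 then b else 0) + (if 2 ≤ d x then c else 0) := by
    intro x _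
    rcases Nat.lt_or_ge (d x) 2 with h | h
    · interval_cases d x <;> simp
    · simp [h, show d x ≠ 0 by omega, show d x ≠ 1 by omega]
  rw [Finset.sum_congr rfl h, Finset.sum_add_distrib, Finset.sum_add_distrib]
  simp only [← Finset.sum_filter, Finset.sum_const, nsmul_eq_mul]
  ring

/-- An `𝓕_{2r+1}`-free coloured graph of large minimum degree has no clique of order `r + 1`. -/
lemma supportGraph_cliqueFree [Fintype V] {r : ℕ} (hr : 2 ≤ r) (hG : IsColoured w)
    (hfree : FamFree w (2 * r + 1))
    (hdeg : ∀ x : V,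
      (6 * (r : ℝ) - 8) / (3 * (r : ℝ) - 1) * (Fintype.card V : ℝ) < ∑ y : V, (w x y : ℝ)) :
    (supportGraph hG).CliqueFree (r + 1) := by
  classical
  intro s hs
  obtain ⟨K, hsK, hK, hext⟩ := exists_extremal_clique hG (s := s) fun x hx y hy hxy =>
    Nat.one_le_iff_ne_zero.2 (hs.isClique hx hy hxy)
  rw [hs.card_eq] at hsK
  have hKne : K.Nonempty := Finset.card_pos.1 (by omega)
  set d : V → ℕ := fun x => {y ∈ K | (blueGraph hG).Adj x y}.card with hd
  have hdsum : ∀ a ∈ K, ∑ y ∈ K.erase a, (2 - (w a y : ℝ)) = d a := by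
    intro a ha
    have : K.filter ((blueGraph hG).Adj a) = (K.erase a).filter fun y => w a y = 1 := by
      ext y
      rw [Finset.mem_filter, Finset.mem_filter, Finset.mem_erase]
      change y ∈ K ∧ w a y = 1 ↔ _
      constructor
      · rintro ⟨hy, h⟩
        refine ⟨⟨?_, hy⟩, h⟩
        rintro rfl
        simp [hG.2.2] at h
      · rintro ⟨⟨_, hy⟩, h⟩
        exact ⟨hy, h⟩
    rw [show d a = _ from congrArg Finset.card this, Finset.card_filter, Nat.cast_sum]
    refine Finset.sum_congr rfl fun y hy => ?_
    obtain ⟨hya, hyK⟩ := Finset.mem_erase.1 hy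
    have h1 := hK a ha y hyK hya.symm
    have h2 := hG.2.1 a y
    interval_cases w a y <;> norm_num
  have hr' : (2 : ℝ) ≤ r := by exact_mod_cast hr
  have hpos : (0 : ℝ) < 3 * r - 1 := by linarith
  have key : ∀ (l : V → ℝ) (m : ℝ), 1 / 4 ≤ m → (∀ x, m ≤ l x) →
      (∀ x ∈ K, 1 ≤ 2 * l x + d x * m) → (3 * (r : ℝ) - 1) / 6 < ∑ x ∈ K, l x := by
    intro l m hm hml hl
    have hD : (6 * (r : ℝ) - 8) / (3 * r - 1) = 2 - 6 / (3 * r - 1) := by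
      rw [div_eq_iff hpos.ne', sub_mul, div_mul_cancel₀ _ hpos.ne']
      ring
    rw [hD] at hdeg
    have hmain := lt_sum_of_deficiency hdeg hG.1 hKne (l := l) (fun x => by linarith [hml x]) ?_
    · rw [div_mul_eq_mul_div, one_lt_div hpos] at hmain
      linarith
    intro v
    obtain ⟨a, haK, hva, hcase⟩ := hext v
    have hc : ∀ y, (0 : ℝ) ≤ 2 - w v y := by
      intro y
      have : (w v y : ℝ) ≤ 2 := by exact_mod_cast hG.2.1 v y
      linarith
    have hlow : m * ∑ y ∈ K.erase a, (2 - (w v y : ℝ))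
        ≤ ∑ y ∈ K.erase a, l y * (2 - (w v y : ℝ)) := by
      rw [Finset.mul_sum]
      exact Finset.sum_le_sum fun y _ => mul_le_mul_of_nonneg_right (hml y) (hc y)
    rw [← Finset.add_sum_erase _ _ haK, hva]
    push_cast
    rcases hcase with ⟨b, hb, hvb⟩ | hle
    · have := Finset.single_le_sum (f := fun y => 2 - (w v y : ℝ)) (fun y _ => hc y) hb
      simp only [hvb] at this
      push_cast at this
      nlinarith [hml a]
    · have hle' : ∑ y ∈ K.erase a, (w v y : ℝ) ≤ ∑ y ∈ K.erase a, (w a y : ℝ) := by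
        exact_mod_cast hle
      have : (d a : ℝ) ≤ ∑ y ∈ K.erase a, (2 - (w v y : ℝ)) := by
        rw [← hdsum a haK, Finset.sum_sub_distrib, Finset.sum_sub_distrib]
        linarith
      nlinarith [hl a haK]
  obtain ⟨I, hIK, hI, hIc⟩ := exists_large_indepSet (blueGraph hG) K
  change 2 * {x ∈ K | d x = 0}.card + {x ∈ K | d x = 1}.card
    + (if ∃ v ∈ K, 2 ≤ d v then 2 else 0) ≤ 2 * I.card at hIc
  have hIred : ∀ x ∈ I, ∀ y ∈ I, x ≠ y → 2 ≤ w x y := by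
    intro x hx y hy hxy
    have h1 := hK x (hIK hx) y (hIK hy) hxy
    have h2 : w x y ≠ 1 := hI hx hy hxy
    omega
  have hcardK : (K.card : ℝ) = 1 * {x ∈ K | d x = 0}.card + 1 * {x ∈ K | d x = 1}.card
      + 1 * {x ∈ K | 2 ≤ d x}.card := by
    rw [← sum_three_values]
    simp
  have hKI := hfree.card_add_card_le hIK hK hIred (by omega) hsK
  have hnat : K.card = {x ∈ K | d x = 0}.card + {x ∈ K | d x = 1}.card
      + {x ∈ K | 2 ≤ d x}.card := by
    simp only [one_mul] at hcardK
    exact_mod_cast hcardK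
  split_ifs at hIc with hv
  · have hlt := key (fun x => if d x = 0 then 1 / 2 else if d x = 1 then 3 / 8 else 1 / 4) (1 / 4)
      le_rfl (fun x => by split_ifs <;> norm_num) ?_
    · rw [sum_three_values] at hlt
      have h1 := hKI (by omega)
      have h2 : (2 * {x ∈ K | d x = 0}.card + {x ∈ K | d x = 1}.card + 2 : ℝ) ≤ 2 * I.card := by
        exact_mod_cast hIc
      have h3 : (K.card + I.card : ℝ) ≤ 2 * r := by exact_mod_cast h1
      linarith
    · intro x _
      split_ifs with h0 h1
      · simp [h0]
      · simp [h1]; norm_num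
      · have : (2 : ℝ) ≤ d x := by exact_mod_cast (show 2 ≤ d x by omega)
        linarith
  · have hd2 : {x ∈ K | 2 ≤ d x}.card = 0 := by
      rw [Finset.card_eq_zero, Finset.filter_eq_empty_iff]
      exact fun x hx h => hv ⟨x, hx, h⟩
    have hlt := key (fun x => if d x = 0 then 1 / 2 else if d x = 1 then 1 / 3 else 1 / 3) (1 / 3)
      (by norm_num) (fun x => by split_ifs <;> norm_num) ?_
    · rw [sum_three_values, hd2] at hlt
      have h1 := hKI (by omega)
      have h2 : (3 * r : ℝ) - 1
          < (3 * {x ∈ K | d x = 0}.card + 2 * {x ∈ K | d x = 1}.card : ℕ) := by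
        push_cast
        push_cast at hlt
        linarith
      have h3 : 3 * r < 3 * {x ∈ K | d x = 0}.card + 2 * {x ∈ K | d x = 1}.card + 1 := by
        have : (3 * r : ℝ)
          < (3 * {x ∈ K | d x = 0}.card + 2 * {x ∈ K | d x = 1}.card : ℕ) + 1 := by linarith
        exact_mod_cast this
      omega
    · intro x _
      split_ifs with h0 h1
      · simp [h0]
      · simp [h1]; norm_num
      · have : (2 : ℝ) ≤ d x := by exact_mod_cast (show 2 ≤ d x by omega)
        linarith

end Coloured

/-- Theorem (odd case): an `𝓕_{2r+1}`-free coloured graph with minimum degree greater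
than `((6r-8)/(3r-1))·n` admits a homomorphism to `RK_r`, i.e. a partition into `r`
classes all of whose internal edges have weight `0`. -/
theorem odd_main {V : Type*} [Fintype V] (r : ℕ) (hr : 2 ≤ r)
    (w : V → V → ℕ) (hG : IsColoured w) (hfree : FamFree w (2 * r + 1))
    (hdeg : ∀ x : V,
      (6 * (r : ℝ) - 8) / (3 * (r : ℝ) - 1) * (Fintype.card V : ℝ) < ∑ y : V, (w x y : ℝ)) :
    ∃ f : V → Fin r, ∀ x y : V, x ≠ y → f x = f y → w x y = 0 := by
  classical
  rcases isEmpty_or_nonempty V with hV | hV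
  · exact ⟨fun x => (hV.false x).elim, fun x => (hV.false x).elim⟩
  have hcol : (supportGraph hG).Colorable r := by
    refine SimpleGraph.colorable_of_cliqueFree_lt_minDegree
      (supportGraph_cliqueFree hr hG hfree hdeg) ?_
    refine lt_of_lt_of_le (Nat.lt_succ_self _)
      (SimpleGraph.le_minDegree_of_forall_le_degree _ _ fun x => ?_)
    rw [Nat.succ_le_iff, Nat.div_lt_iff_lt_mul (by omega)]
    have hle : ∑ y : V, w x y ≤ 2 * (supportGraph hG).degree x := by
      rw [← SimpleGraph.card_neighborFinset_eq_degree, SimpleGraph.neighborFinset_eq_filter,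
        Finset.card_filter, Finset.mul_sum]
      refine Finset.sum_le_sum fun y _ => ?_
      have := hG.2.1 x y
      by_cases h : w x y = 0 <;> simp [supportGraph, h, this]
    have hle' : (∑ y : V, (w x y : ℝ)) ≤ 2 * ((supportGraph hG).degree x : ℝ) := by
      exact_mod_cast hle
    have hr' : (2 : ℝ) ≤ r := by exact_mod_cast hr
    have hpos : (0 : ℝ) < 3 * r - 1 := by linarith
    have h := (hdeg x).trans_le hle'
    rw [div_mul_eq_mul_div, div_lt_iff₀ hpos] at h
    have hcast : (((3 * r - 4) * Fintype.card V : ℕ) : ℝ)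
        < (((supportGraph hG).degree x * (3 * r - 1) : ℕ) : ℝ) := by
      push_cast [Nat.cast_sub (show 4 ≤ 3 * r by omega), Nat.cast_sub (show 1 ≤ 3 * r by omega)]
      linarith
    exact_mod_cast hcast
  obtain ⟨c⟩ := hcol
  refine ⟨c, fun x y _ hc => ?_⟩
  by_contra hw
  exact c.valid (show (supportGraph hG).Adj x y from hw) hc
end

section
/- Let r ≥ 3 be an integer and let G be an 𝓕_{2r}-free coloured graph on n vertices with δ(G) > ((14r−24)/(7r−5))·n. Then there is a homomorphism from G to RK_r^-; explicitly, there is a partition V(G) = W_1 ∪ … ∪ W_r into r classes such that w(x,y) = 0 for any two distinct vertices x, y in the same class, and w(x,y) ≤ 1 for every x ∈ W_1 and y ∈ W_2. -/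
/-- In an `𝓕_{2r}`-free coloured graph, the order of a clique and that of a red clique inside it
sum to less than `2r`. -/
theorem FamFree.card_add_card_lt {V : Type*} {w : V → V → ℕ} {r : ℕ} (hr : 1 ≤ r)
    (hfree : FamFree w (2 * r)) {S T : Finset V} (hTS : T ⊆ S) (hT : T.Nonempty)
    (hS : ∀ x ∈ S, ∀ y ∈ S, x ≠ y → 1 ≤ w x y) (hT2 : ∀ x ∈ T, ∀ y ∈ T, x ≠ y → 2 ≤ w x y) :
    S.card + T.card < 2 * r := by
  classical
  by_contra! hcard
  have hle : T.card ≤ S.card := Finset.card_le_card hTS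
  have hpos : 1 ≤ T.card := hT.card_pos
  obtain ⟨i, hi, hiT, hir, hiS⟩ : ∃ i, 1 ≤ i ∧ i ≤ T.card ∧ i ≤ r ∧ 2 * r - i ≤ S.card := by
    refine ⟨min T.card r, ?_, ?_, ?_, ?_⟩ <;> omega
  obtain ⟨T', hT'T, hT'⟩ := Finset.exists_subset_card_eq hiT
  obtain ⟨S', hTS', hS'S, hS'⟩ :=
    Finset.exists_subsuperset_card_eq (hT'T.trans hTS) (n := 2 * r - i) (by omega) hiS
  have hdiff : (S' \ T').card = 2 * r - i - i := by
    rw [Finset.card_sdiff_of_subset hTS', hS', hT']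
  let e := T'.equivFinOfCardEq hT'
  let e' := (S' \ T').equivFinOfCardEq hdiff
  let φ : Fin (2 * r - i) → V := fun k =>
    if h : k.val < i then e.symm ⟨k, h⟩ else e'.symm ⟨k - i, by omega⟩
  have hφT : ∀ k : Fin (2 * r - i), k.val < i → φ k ∈ T' := by
    intro k hk
    simp only [φ, hk, dif_pos]
    exact (e.symm _).2
  have hφS : ∀ k : Fin (2 * r - i), ¬ k.val < i → φ k ∈ S' \ T' := by
    intro k hk
    simp only [φ, hk, dif_neg, not_false_eq_true]
    exact (e'.symm _).2
  have hφ : ∀ k, φ k ∈ S := by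
    intro k
    by_cases hk : k.val < i
    · exact hTS (hT'T (hφT k hk))
    · exact hS'S (Finset.mem_sdiff.1 (hφS k hk)).1
  have hinj : Function.Injective φ := by
    intro a b hab
    by_cases ha : a.val < i <;> by_cases hb : b.val < i
    · simp only [φ, ha, hb, dif_pos] at hab
      have := e.symm.injective (Subtype.ext hab)
      simpa [Fin.ext_iff] using this
    · exact absurd (hab ▸ hφT a ha) (Finset.mem_sdiff.1 (hφS b hb)).2
    · exact absurd (hab ▸ hφT b hb) (Finset.mem_sdiff.1 (hφS a ha)).2
    · simp only [φ, ha, hb, dif_neg, not_false_eq_true] at hab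
      have := e'.symm.injective (Subtype.ext hab)
      simp only [Fin.mk.injEq] at this
      ext
      omega
  refine hfree i hi (by omega) ⟨φ, hinj, fun x y => ?_⟩
  unfold Gt
  split_ifs with hxy hlt
  · exact Nat.zero_le _
  · exact hT2 _ (hT'T (hφT x hlt.1)) _ (hT'T (hφT y hlt.2)) (hinj.ne hxy)
  · exact hS _ (hφ x) _ (hφ y) (hinj.ne hxy)

/-- The Lagrangian of the complementary weights `2 - w` is attained by a weight distribution
supported on a clique and with constant weighted deficiency on its support. -/
theorem exists_optimal_distribution {V : Type*} [Fintype V] [Nonempty V] {w : V → V → ℕ}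
    (hG : IsColoured w) :
    ∃ (α : V → ℝ) (q : ℝ), (∀ x, 0 ≤ α x) ∧ ∑ x, α x = 1 ∧
      (∀ x y, 0 < α x → 0 < α y → x ≠ y → 1 ≤ w x y) ∧
      (∀ x, 0 < α x → ∑ y, α y * (2 - w x y : ℝ) = q) ∧
      q * (Fintype.card V : ℝ) ^ 2 ≤ ∑ x, ∑ y, (2 - w x y : ℝ) := by
  classical
  obtain ⟨hsymm, -, hdiag⟩ := hG
  let g : (V → ℝ) → V → ℝ := fun α x => ∑ y, α y * (2 - w x y : ℝ)
  let Q : (V → ℝ) → ℝ := fun α => ∑ x, α x * g α x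
  have hgcont : ∀ x, Continuous fun α => g α x := fun x => by
    simp only [g]; fun_prop
  have hcont : Continuous Q := by
    simp only [Q]
    exact continuous_finsetSum _ fun x _ => (continuous_apply x).mul (hgcont x)
  have hne : (stdSimplex ℝ V).Nonempty :=
    ⟨_, single_mem_stdSimplex ℝ (Classical.arbitrary V)⟩
  obtain ⟨α₀, hα₀, hmin₀⟩ :=
    (isCompact_stdSimplex ℝ V).exists_isMinOn hne hcont.continuousOn
  let minimal : (V → ℝ) → Prop := fun α => α ∈ stdSimplex ℝ V ∧ Q α = Q α₀
  let supp : (V → ℝ) → ℕ := fun α => (Finset.univ.filter fun x => 0 < α x).card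
  have hex : ∃ k, ∃ α, minimal α ∧ supp α = k := ⟨_, α₀, ⟨hα₀, rfl⟩, rfl⟩
  obtain ⟨α, ⟨hα, hαQ⟩, hαs⟩ := Nat.find_spec hex
  have hleast : ∀ β, minimal β → supp α ≤ supp β := fun β hβ => by
    rw [hαs]; exact Nat.find_min' hex ⟨β, hβ, rfl⟩
  have hmin : ∀ β ∈ stdSimplex ℝ V, Q α ≤ Q β := fun β hβ => hαQ ▸ hmin₀ hβ
  -- moving an amount `ε` of weight from `y` to `x`
  let shift : V → V → ℝ → V → ℝ := fun x y ε => α + ε • (Pi.single x 1 - Pi.single y 1)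
  have hgshift : ∀ x y ε z, g (shift x y ε) z = g α z + ε * ((w y z : ℝ) - w x z) := by
    intro x y ε z
    simp only [g, shift, Pi.add_apply, Pi.smul_apply, Pi.sub_apply, smul_eq_mul, add_mul,
      Finset.sum_add_distrib, mul_assoc, ← Finset.mul_sum, sub_mul, Finset.sum_sub_distrib,
      Pi.single_apply, ite_mul, one_mul, zero_mul, Finset.sum_ite_eq', Finset.mem_univ, if_true]
    rw [hsymm z x, hsymm z y]; ring
  have hsumw : ∀ x, ∑ z, α z * (w x z : ℝ) = 2 * ∑ z, α z - g α x := by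
    intro x
    simp only [g, mul_sub, Finset.sum_sub_distrib, Finset.mul_sum]
    simp only [mul_comm]; ring
  have hQshift : ∀ x y ε, x ≠ y →
      Q (shift x y ε) = Q α + 2 * ε * (g α x - g α y) + 2 * ε ^ 2 * w x y := by
    intro x y ε hxy
    have h1 : Q (shift x y ε) = ∑ z, α z * g (shift x y ε) z
        + ε * (g (shift x y ε) x - g (shift x y ε) y) := by
      simp only [Q, shift, Pi.add_apply, Pi.smul_apply, Pi.sub_apply, smul_eq_mul, add_mul,
        Finset.sum_add_distrib, mul_assoc, ← Finset.mul_sum, sub_mul, Finset.sum_sub_distrib,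
        Pi.single_apply, ite_mul, one_mul, zero_mul, Finset.sum_ite_eq', Finset.mem_univ, if_true]
    have h2 : ∑ z, α z * g (shift x y ε) z
        = Q α + ε * (∑ z, α z * (w y z : ℝ) - ∑ z, α z * (w x z : ℝ)) := by
      simp only [hgshift, mul_add, Finset.sum_add_distrib, Q, mul_sub, Finset.mul_sum,
        Finset.sum_sub_distrib, mul_left_comm]
    rw [h1, h2, hsumw, hsumw, hgshift, hgshift, hdiag, hdiag, hsymm y x]
    push_cast; ring
  have hshiftmem : ∀ x y ε, x ≠ y → -α x ≤ ε → ε ≤ α y → shift x y ε ∈ stdSimplex ℝ V := by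
    intro x y ε hxy h1 h2
    refine ⟨fun z => ?_, ?_⟩
    · have := hα.1 z
      simp only [shift, Pi.add_apply, Pi.smul_apply, Pi.sub_apply, smul_eq_mul, Pi.single_apply]
      split_ifs with hzx hzy hzy
      · exact absurd (hzx.symm.trans hzy) hxy
      · subst hzx; linarith
      · subst hzy; linarith
      · linarith
    · have := hα.2
      simp only [shift, Pi.add_apply, Pi.smul_apply, Pi.sub_apply, smul_eq_mul,
        Finset.sum_add_distrib, ← Finset.mul_sum, Finset.sum_sub_distrib, Finset.sum_pi_single',
        Finset.mem_univ, if_true, this]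
      ring
  have hgle : ∀ x y, 0 < α x → 0 < α y → g α y ≤ g α x := by
    intro x y hx hy
    by_contra! hlt
    have hxy : x ≠ y := by rintro rfl; exact lt_irrefl _ hlt
    have hw : (0 : ℝ) ≤ w x y := Nat.cast_nonneg _
    set δ := g α y - g α x with hδ
    have hδ0 : 0 < δ := sub_pos.2 hlt
    set ε := min (α y) (δ / (w x y + 1)) with hε
    have hε0 : 0 < ε := lt_min hy (by positivity)
    have hε1 : ε * (w x y + 1) ≤ δ := by
      rw [← le_div_iff₀ (by positivity)]; exact min_le_right _ _
    have := hmin _ (hshiftmem x y ε hxy (by linarith) (min_le_left _ _))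
    rw [hQshift x y ε hxy] at this
    nlinarith [mul_pos hε0 hε0]
  have hgeq : ∀ x y, 0 < α x → 0 < α y → g α x = g α y := fun x y hx hy =>
    le_antisymm (hgle y x hy hx) (hgle x y hx hy)
  have hpos_of_ne : ∀ x, ¬ 0 < α x → α x = 0 := fun x hx => le_antisymm (not_lt.1 hx) (hα.1 x)
  obtain ⟨x₀, hx₀⟩ : ∃ x, 0 < α x := by
    by_contra! h
    have : ∑ x, α x ≤ 0 := Finset.sum_nonpos fun x _ => h x
    rw [hα.2] at this
    linarith
  have hQ : Q α = g α x₀ := by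
    have : ∀ x ∈ Finset.univ, α x * g α x = α x * g α x₀ := fun x _ => by
      by_cases hx : 0 < α x
      · rw [hgeq x x₀ hx hx₀]
      · rw [hpos_of_ne x hx, zero_mul, zero_mul]
    simp only [Q]
    rw [Finset.sum_congr rfl this, ← Finset.sum_mul, hα.2, one_mul]
  refine ⟨α, g α x₀, hα.1, hα.2, fun x y hx hy hxy => ?_, fun x hx => hgeq x x₀ hx hx₀, ?_⟩
  · by_contra! hlt
    have hw0 : w x y = 0 := by omega
    have hmem := hshiftmem x y (α y) hxy (by linarith) le_rfl
    have hQ' := hQshift x y (α y) hxy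
    rw [hgeq x y hx hy, hw0] at hQ'
    have hle := hleast (shift x y (α y)) ⟨hmem, by rw [hQ', ← hαQ]; simp⟩
    refine absurd hle (not_le.2 (Finset.card_lt_card ?_))
    refine (Finset.ssubset_iff_of_subset fun z hz => ?_).2 ⟨y, by simpa using hy, ?_⟩
    · simp only [Finset.mem_filter, Finset.mem_univ, true_and, shift, Pi.add_apply, Pi.smul_apply,
        Pi.sub_apply, smul_eq_mul, Pi.single_apply] at hz ⊢
      split_ifs at hz with hzx hzy hzy
      · exact hzx ▸ hx
      · exact hzx ▸ hx
      · exact hzy ▸ hy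
      · linarith
    · simp [shift, Pi.single_apply, hxy.symm]
  · have hn : (0 : ℝ) < Fintype.card V := by exact_mod_cast Fintype.card_pos
    have hu : (fun _ : V => ((Fintype.card V : ℝ))⁻¹) ∈ stdSimplex ℝ V := by
      refine ⟨fun _ => by positivity, ?_⟩
      simp [hn.ne']
    have := hmin _ hu
    rw [hQ] at this
    simp only [Q, g, ← Finset.mul_sum] at this
    calc _ ≤ (_ * (_ * _)) * (Fintype.card V : ℝ) ^ 2 := by gcongr
      _ = _ := by field_simp

/-- The dual form of the Lagrangian bound: the support `S` of an optimal weight distribution is a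
clique on which no cheap weighting covers every vertex. -/
theorem exists_clique_forall_weighting {V : Type*} [Fintype V] [Nonempty V] {w : V → V → ℕ}
    {m : ℕ} (hG : IsColoured w) {η : ℝ} (hcard : (Fintype.card V : ℝ) = (7 * m + 9) * η)
    (hdeg : ∀ x, ∑ y, (2 - w x y : ℝ) < 14 * η) :
    ∃ S : Finset V, S.Nonempty ∧ (∀ x ∈ S, ∀ y ∈ S, x ≠ y → 1 ≤ w x y) ∧
      ∀ β : V → ℝ, (∀ x, 0 ≤ β x) → (∀ y ∈ S, 12 ≤ ∑ x ∈ S, β x * (2 - w x y : ℝ)) →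
        6 * (m : ℝ) + 7 < ∑ x ∈ S, β x := by
  classical
  obtain ⟨α, q, hα0, hα1, hclique, hgq, hq⟩ := exists_optimal_distribution hG
  have hn : (0 : ℝ) < Fintype.card V := by exact_mod_cast Fintype.card_pos
  have hq14 : q * (7 * m + 9) < 14 := by
    have h1 : ∑ x, ∑ y, (2 - w x y : ℝ) < ∑ _x : V, 14 * η :=
      Finset.sum_lt_sum_of_nonempty Finset.univ_nonempty fun x _ => hdeg x
    simp only [Finset.sum_const, Finset.card_univ, nsmul_eq_mul] at h1
    have h2 := hq.trans_lt h1
    have hη : 0 < η := by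
      by_contra! h
      have : (7 * (m : ℝ) + 9) * η ≤ 0 := mul_nonpos_of_nonneg_of_nonpos (by positivity) h
      linarith
    have h3 : Fintype.card V * η * (q * (7 * m + 9)) < Fintype.card V * η * 14 := by
      calc _ = q * (Fintype.card V : ℝ) ^ 2 := by rw [pow_two]; nth_rw 2 [hcard]; ring
        _ < _ := h2
        _ = _ := by ring
    exact lt_of_mul_lt_mul_left h3 (by positivity)
  set S := Finset.univ.filter fun x => 0 < α x with hSdef
  have hS : ∀ x ∈ S, ∀ y ∈ S, x ≠ y → 1 ≤ w x y := by
    intro x hx y hy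
    exact hclique x y (by simpa [hSdef] using hx) (by simpa [hSdef] using hy)
  have hne : S.Nonempty := by
    by_contra h
    rw [Finset.not_nonempty_iff_eq_empty] at h
    have : ∑ x, α x ≤ 0 := Finset.sum_nonpos fun x _ => by
      by_contra! hx
      have : x ∈ S := by simpa [hSdef] using hx
      simp [h] at this
    linarith
  refine ⟨S, hne, hS, ?_⟩
  intro β hβ0 hβ
  have h1 : (12 : ℝ) ≤ q * ∑ x ∈ S, β x := by
    calc (12 : ℝ) = ∑ y, α y * 12 := by rw [← Finset.sum_mul, hα1, one_mul]
      _ ≤ ∑ y, α y * ∑ x ∈ S, β x * (2 - w x y : ℝ) := by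
          refine Finset.sum_le_sum fun y _ => ?_
          by_cases hy : 0 < α y
          · exact mul_le_mul_of_nonneg_left (hβ y (by simpa [hSdef] using hy)) hy.le
          · have : α y = 0 := le_antisymm (not_lt.1 hy) (hα0 y)
            simp [this]
      _ = ∑ x ∈ S, β x * ∑ y, α y * (2 - w x y : ℝ) := by
          simp only [Finset.mul_sum]
          rw [Finset.sum_comm]
          simp only [mul_left_comm]
      _ = q * ∑ x ∈ S, β x := by
          rw [Finset.mul_sum]
          refine Finset.sum_congr rfl fun x hx => ?_
          rw [hgq x (by simpa [hSdef] using hx), mul_comm]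
  by_contra! h2
  have h3 : (0 : ℝ) ≤ ∑ x ∈ S, β x := Finset.sum_nonneg fun x _ => hβ0 x
  have hq0 : 0 < q := by
    by_contra! h
    nlinarith
  nlinarith
/-- A largest red clique `I` in a clique `S` whose orders sum to `2m + 3`, where no cheap
weighting of `S` covers every vertex. -/
structure IsTightPair {V : Type*} (w : V → V → ℕ) (m : ℕ) (S I : Finset V) : Prop where
  symm : ∀ x y, w x y = w y x
  le_two : ∀ x y, w x y ≤ 2
  diag : ∀ x, w x x = 0
  subset : I ⊆ S
  red : ∀ x ∈ I, ∀ y ∈ I, x ≠ y → 2 ≤ w x y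
  card_le : ∀ T ⊆ S, (∀ x ∈ T, ∀ y ∈ T, x ≠ y → 2 ≤ w x y) → T.card ≤ I.card
  weight : ∀ β : V → ℝ, (∀ x, 0 ≤ β x) → (∀ y ∈ S, 12 ≤ ∑ x ∈ S, β x * (2 - w x y : ℝ)) →
    6 * (m : ℝ) + 7 < ∑ x ∈ S, β x
  card_add_card_lt : S.card + I.card < 2 * m + 4

namespace IsTightPair

variable {V : Type*} [DecidableEq V] {w : V → V → ℕ} {m : ℕ} {S I : Finset V}

theorem le_sum (h : IsTightPair w m S I) {β : V → ℝ} (hβ : ∀ x, 0 ≤ β x) {y : V} (hy : y ∈ S)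
    {T : Finset V} (hTS : T ⊆ S) (hyT : y ∉ T) (hT : ∀ x ∈ T, w x y ≤ 1) :
    2 * β y + ∑ x ∈ T, β x ≤ ∑ x ∈ S, β x * (2 - w x y : ℝ) := by
  calc 2 * β y + ∑ x ∈ T, β x ≤ 2 * β y + ∑ x ∈ T, β x * (2 - w x y : ℝ) := by
        gcongr with x hx
        have : (w x y : ℝ) ≤ 1 := by exact_mod_cast hT x hx
        nlinarith [hβ x]
    _ = ∑ x ∈ insert y T, β x * (2 - w x y : ℝ) := by
        rw [Finset.sum_insert hyT, h.diag]; push_cast; ring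
    _ ≤ _ := Finset.sum_le_sum_of_subset_of_nonneg (Finset.insert_subset hy hTS) fun x _ _ => by
        have : (w x y : ℝ) ≤ 2 := by exact_mod_cast h.le_two x y
        exact mul_nonneg (hβ x) (by linarith)

theorem exists_blue (h : IsTightPair w m S I) {o : V} (ho : o ∈ S) (hoI : o ∉ I) :
    ∃ x ∈ I, w x o ≤ 1 := by
  by_contra! hlt
  have := h.card_le (insert o I) (Finset.insert_subset ho h.subset) (by
    intro x hx y hy hxy
    rw [Finset.mem_insert] at hx hy
    rcases hx with rfl | hx <;> rcases hy with rfl | hy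
    · exact absurd rfl hxy
    · rw [h.symm]; exact hlt y hy
    · exact hlt x hx
    · exact h.red x hx y hy hxy)
  rw [Finset.card_insert_of_notMem hoI] at this
  omega

theorem sum_indicator (h : IsTightPair w m S I) :
    ∑ x ∈ S, (if x ∈ I then (3 : ℝ) else 0) = 3 * I.card := by
  rw [← Finset.sum_filter, Finset.filter_mem_eq_inter, Finset.inter_eq_right.2 h.subset]
  simp [mul_comm]

theorem weight' (h : IsTightPair w m S I) (γ : V → ℝ)
    (hγ : ∀ x, 0 ≤ 3 + (if x ∈ I then 3 else 0) + γ x)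
    (hT : ∀ y ∈ S, ∃ T ⊆ S, y ∉ T ∧ (∀ x ∈ T, w x y ≤ 1) ∧
      12 ≤ 2 * (3 + (if y ∈ I then 3 else 0) + γ y)
        + ∑ x ∈ T, (3 + (if x ∈ I then 3 else 0) + γ x)) :
    6 * (m : ℝ) + 7 < 3 * (S.card + I.card) + ∑ x ∈ S, γ x := by
  have := h.weight _ hγ fun y hy => by
    obtain ⟨T, hTS, hyT, hT1, hT2⟩ := hT y hy
    exact hT2.trans (h.le_sum hγ hy hTS hyT hT1)
  rw [Finset.sum_add_distrib, Finset.sum_add_distrib, h.sum_indicator, Finset.sum_const,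
    nsmul_eq_mul] at this
  linarith

theorem card_add_card (h : IsTightPair w m S I) : S.card + I.card = 2 * m + 3 := by
  by_contra hne
  have hlt := h.card_add_card_lt
  have hle : (S.card + I.card : ℝ) ≤ 2 * m + 2 := by
    exact_mod_cast (by omega : S.card + I.card ≤ 2 * m + 2)
  have := h.weight' (fun _ => 0) (fun x => by split_ifs <;> norm_num) fun y hy => by
    by_cases hyI : y ∈ I
    · refine ⟨∅, by simp, by simp, by simp, ?_⟩
      simp only [hyI, Finset.sum_empty, if_true]; norm_num
    · obtain ⟨x, hx, hxy⟩ := h.exists_blue hy hyI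
      refine ⟨{x}, by simpa using h.subset hx, by rintro h; simp_all, by simpa using hxy, ?_⟩
      simp only [hyI, hx, Finset.sum_singleton, if_true, if_false]; norm_num
  simp only [Finset.sum_const_zero] at this
  linarith

theorem sum_lt (h : IsTightPair w m S I) (γ : V → ℝ)
    (hγ : ∀ x, 0 ≤ 3 + (if x ∈ I then 3 else 0) + γ x)
    (hT : ∀ y ∈ S, ∃ T ⊆ S, y ∉ T ∧ (∀ x ∈ T, w x y ≤ 1) ∧
      12 ≤ 2 * (3 + (if y ∈ I then 3 else 0) + γ y)
        + ∑ x ∈ T, (3 + (if x ∈ I then 3 else 0) + γ x)) :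
    -2 < ∑ x ∈ S, γ x := by
  have h1 := h.weight' γ hγ hT
  have h2 : (S.card + I.card : ℝ) = 2 * m + 3 := by exact_mod_cast h.card_add_card
  linarith

/-- No vertex outside sends two blue edges to the red clique. -/
theorem blue_unique (h : IsTightPair w m S I) {o a b : V} (ho : o ∈ S) (hoI : o ∉ I) (ha : a ∈ I)
    (hb : b ∈ I) (hao : w a o ≤ 1) (hbo : w b o ≤ 1) : a = b := by
  by_contra hab
  have hne : ∀ {x}, x ∈ I → x ≠ o := fun hx => ne_of_mem_of_not_mem hx hoI
  have := h.sum_lt (fun x => if x = o then -3 else 0)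
    (fun x => by split_ifs <;> norm_num) fun y hy => by
    by_cases hyI : y ∈ I
    · refine ⟨∅, by simp, by simp, by simp, ?_⟩
      simp only [hyI, hne hyI, Finset.sum_empty, if_true, if_false]; norm_num
    · by_cases hyo : y = o
      · subst hyo
        refine ⟨{a, b}, by simp [Finset.insert_subset_iff, h.subset ha, h.subset hb],
          by simp [(hne ha).symm, (hne hb).symm], by simp [hao, hbo], ?_⟩
        simp only [hyI, ha, hb, hne ha, hne hb, Finset.sum_pair hab, if_true, if_false]; norm_num
      · obtain ⟨x, hx, hxy⟩ := h.exists_blue hy hyI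
        refine ⟨{x}, by simpa using h.subset hx, by rintro h; simp_all, by simpa using hxy, ?_⟩
        simp only [hyI, hx, hyo, hne hx, Finset.sum_singleton, if_true, if_false]; norm_num
  rw [Finset.sum_ite_eq' S o, if_pos ho] at this
  linarith

/-- Outside vertices with the same blue neighbour in the red clique are not joined in red. -/
theorem le_one_of_blue (h : IsTightPair w m S I) {p p' a : V} (hp : p ∈ S) (hpI : p ∉ I)
    (hp' : p' ∈ S) (hpI' : p' ∉ I) (hpp : p ≠ p') (ha : a ∈ I) (hap : w a p ≤ 1)
    (hap' : w a p' ≤ 1) : w p p' ≤ 1 := by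
  by_contra! hlt
  have hred : ∀ s ∈ S, s ∉ I → w a s ≤ 1 → ∀ x ∈ I, x ≠ a → 2 ≤ w x s := by
    intro s hs hsI has x hx hxa
    by_contra! hh
    exact hxa (h.blue_unique hs hsI hx ha (by omega) has)
  have := h.card_le (insert p (insert p' (I.erase a)))
    (Finset.insert_subset hp (Finset.insert_subset hp' ((Finset.erase_subset _ _).trans h.subset)))
    (by
      intro x hx y hy hxy
      simp only [Finset.mem_insert, Finset.mem_erase] at hx hy
      rcases hx with rfl | rfl | ⟨hxa, hx⟩ <;> rcases hy with rfl | rfl | ⟨hya, hy⟩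
      · exact absurd rfl hxy
      · exact hlt
      · rw [h.symm]; exact hred _ hp hpI hap y hy hya
      · rw [h.symm]; exact hlt
      · exact absurd rfl hxy
      · rw [h.symm]; exact hred _ hp' hpI' hap' y hy hya
      · exact hred _ hp hpI hap x hx hxa
      · exact hred _ hp' hpI' hap' x hx hxa
      · exact h.red x hx y hy hxy)
  have hpos := Finset.card_pos.2 ⟨a, ha⟩
  rw [Finset.card_insert_of_notMem (by simp [hpp, hpI]),
    Finset.card_insert_of_notMem (by simp [hpI']), Finset.card_erase_of_mem ha] at this
  omega

/-- Outside vertices send their blue edges to distinct vertices of the red clique. -/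
theorem blue_injective (h : IsTightPair w m S I) {o o' a : V} (ho : o ∈ S) (hoI : o ∉ I)
    (ho' : o' ∈ S) (hoI' : o' ∉ I) (ha : a ∈ I) (hao : w a o ≤ 1) (hao' : w a o' ≤ 1) :
    o = o' := by
  by_contra hoo
  have hne : ∀ {x y}, x ∈ I → y ∉ I → x ≠ y := fun hx hy => ne_of_mem_of_not_mem hx hy
  have := h.sum_lt (fun x => if x = a then -2 else 0)
    (fun x => by split_ifs <;> norm_num) fun y hy => by
    by_cases hyI : y ∈ I
    · by_cases hya : y = a
      · subst hya
        refine ⟨{o, o'}, by simp [Finset.insert_subset_iff, ho, ho'],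
          by simp [hne ha hoI, hne ha hoI'], by simp [h.symm _ y, hao, hao'], ?_⟩
        simp only [ha, hoI, hoI', (hne ha hoI).symm, (hne ha hoI').symm, Finset.sum_pair hoo,
          if_true, if_false]; norm_num
      · refine ⟨∅, by simp, by simp, by simp, ?_⟩
        simp only [hyI, hya, Finset.sum_empty, if_true, if_false]; norm_num
    · obtain ⟨x, hx, hxy⟩ := h.exists_blue hy hyI
      have hya := (hne ha hyI).symm
      have hyx := (hne hx hyI).symm
      by_cases hxa : x = a
      · subst hxa
        obtain ⟨p, hp, hpI, hpy, hxp⟩ : ∃ p ∈ S, p ∉ I ∧ p ≠ y ∧ w x p ≤ 1 := by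
          by_cases hyo : o = y
          · exact ⟨o', ho', hoI', by rw [← hyo]; exact Ne.symm hoo, hao'⟩
          · exact ⟨o, ho, hoI, hyo, hao⟩
        have hxp' := hne hx hpI
        refine ⟨{x, p}, by simp [Finset.insert_subset_iff, hp, h.subset hx],
          by simp [hyx, hpy.symm],
          by simp [hxy, h.le_one_of_blue hp hpI hy hyI hpy hx hxp hxy], ?_⟩
        simp only [hyI, hpI, hx, hya, hxp'.symm, Finset.sum_pair hxp', if_true, if_false]
        norm_num
      · refine ⟨{x}, by simpa using h.subset hx, by simp [hyx], by simpa using hxy, ?_⟩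
        simp only [hyI, hx, hxa, hya, Finset.sum_singleton, if_true, if_false]; norm_num
  rw [Finset.sum_ite_eq' S a, if_pos (h.subset ha)] at this
  linarith

/-- At most one vertex of the clique lies outside the red clique. -/
theorem eq_of_notMem (h : IsTightPair w m S I) {o o' : V} (ho : o ∈ S) (hoI : o ∉ I)
    (ho' : o' ∈ S) (hoI' : o' ∉ I) : o = o' := by
  by_contra hoo
  have hne : ∀ {x y}, x ∈ I → y ∉ I → x ≠ y := fun hx hy => ne_of_mem_of_not_mem hx hy
  obtain ⟨a, ha, hao⟩ := h.exists_blue ho hoI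
  obtain ⟨a', ha', hao'⟩ := h.exists_blue ho' hoI'
  have haa : a ≠ a' := by
    rintro rfl
    exact hoo (h.blue_injective ho hoI ho' hoI' ha hao hao')
  have h1 := hne ha hoI
  have h2 := hne ha hoI'
  have h3 := hne ha' hoI
  have h4 := hne ha' hoI'
  have := h.sum_lt (fun x => (if x = a then -2 else 0) + (if x = a' then -2 else 0)
      + (if x = o then 1 else 0) + (if x = o' then 1 else 0))
    (fun x => by
      by_cases hxa : x = a
      · subst hxa; simp only [ha, haa, h1, h2, if_true, if_false]; norm_num
      · simp only [hxa, if_false]; split_ifs <;> norm_num) fun y hy => by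
    by_cases hya : y = a
    · subst hya
      refine ⟨{o}, by simpa using ho, by simp [h1], by simpa [h.symm o] using hao, ?_⟩
      simp only [ha, haa, h1, h2, hoI, hoo, h1.symm, h3.symm, Finset.sum_singleton, if_true,
        if_false]; norm_num
    by_cases hya' : y = a'
    · subst hya'
      refine ⟨{o'}, by simpa using ho', by simp [h4], by simpa [h.symm o'] using hao', ?_⟩
      simp only [ha', haa.symm, h3, h4, hoI', Ne.symm hoo, h2.symm, h4.symm,
        Finset.sum_singleton, if_true, if_false]; norm_num
    by_cases hyo : y = o
    · subst hyo
      refine ⟨{a}, by simpa using h.subset ha, by simp [h1.symm], by simpa using hao, ?_⟩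
      simp only [ha, haa, h1, h2, hoI, hoo, h1.symm, h3.symm, Finset.sum_singleton, if_true,
        if_false]; norm_num
    by_cases hyo' : y = o'
    · subst hyo'
      refine ⟨{a'}, by simpa using h.subset ha', by simp [h4.symm], by simpa using hao', ?_⟩
      simp only [ha', haa.symm, h3, h4, hoI', Ne.symm hoo, h2.symm, h4.symm,
        Finset.sum_singleton, if_true, if_false]; norm_num
    by_cases hyI : y ∈ I
    · refine ⟨∅, by simp, by simp, by simp, ?_⟩
      simp only [hyI, hya, hya', hyo, hyo', Finset.sum_empty, if_true, if_false]; norm_num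
    · obtain ⟨x, hx, hxy⟩ := h.exists_blue hy hyI
      have hxa : x ≠ a := by
        rintro rfl
        exact hyo (h.blue_injective hy hyI ho hoI hx hxy hao)
      have hxa' : x ≠ a' := by
        rintro rfl
        exact hyo' (h.blue_injective hy hyI ho' hoI' hx hxy hao')
      refine ⟨{x}, by simpa using h.subset hx, by simp [(hne hx hyI).symm], by simpa using hxy, ?_⟩
      simp only [hyI, hx, hya, hya', hyo, hyo', hxa, hxa', hne hx hoI, hne hx hoI',
        Finset.sum_singleton, if_true, if_false]; norm_num
  simp only [Finset.sum_add_distrib, Finset.sum_ite_eq', h.subset ha, h.subset ha', ho, ho',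
    if_true] at this
  linarith

end IsTightPair

/-- An `𝓕_{2r}`-free coloured graph of minimum degree more than `((14r-24)/(7r-5))·n` contains
`RK_r^-`, here presented as a red clique on `r - 2` vertices joined in red to both ends of an
edge. -/
theorem exists_red_clique_join_edge {V : Type*} [Fintype V] [Nonempty V] {w : V → V → ℕ} {m : ℕ}
    (hG : IsColoured w) (hfree : FamFree w (2 * (m + 2))) {η : ℝ}
    (hcard : (Fintype.card V : ℝ) = (7 * m + 9) * η)
    (hdeg : ∀ x, ∑ y, (2 - w x y : ℝ) < 14 * η) :
    ∃ (u u' : V) (v : Fin m → V), (∀ i j, i ≠ j → w (v i) (v j) = 2) ∧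
      (∀ i, w u (v i) = 2) ∧ (∀ i, w u' (v i) = 2) ∧ 1 ≤ w u u' := by
  classical
  obtain ⟨S, ⟨x₀, hx₀⟩, hS, hdual⟩ := exists_clique_forall_weighting hG hcard hdeg
  obtain ⟨hsymm, hle2, hdiag⟩ := hG
  obtain ⟨I, hI, hImax⟩ := Finset.exists_max_image
    (S.powerset.filter fun T => ∀ x ∈ T, ∀ y ∈ T, x ≠ y → 2 ≤ w x y) Finset.card
    ⟨∅, by simp⟩
  simp only [Finset.mem_filter, Finset.mem_powerset] at hI hImax
  obtain ⟨hIS, hI2⟩ := hI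
  have hIne : I.Nonempty := by
    have := hImax {x₀} ⟨by simpa using hx₀, by simp⟩
    rw [Finset.card_singleton] at this
    exact Finset.card_pos.1 this
  have h : IsTightPair w m S I :=
    { symm := hsymm, le_two := hle2, diag := hdiag, subset := hIS, red := hI2
      card_le := fun T hT hT2 => hImax T ⟨hT, hT2⟩
      weight := hdual
      card_add_card_lt := hfree.card_add_card_lt (by omega) hIS hIne hS hI2 }
  have hcard' := h.card_add_card
  have hIcard : I.card ≤ S.card := Finset.card_le_card hIS
  have hsdiff : (S \ I).card = S.card - I.card := Finset.card_sdiff_of_subset hIS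
  have hsdiff1 : (S \ I).card ≤ 1 := by
    rw [Finset.card_le_one]
    intro o ho o' ho'
    rw [Finset.mem_sdiff] at ho ho'
    exact h.eq_of_notMem ho.1 ho.2 ho'.1 ho'.2
  obtain ⟨o, ho⟩ : (S \ I).Nonempty := by
    rw [← Finset.card_pos]; omega
  rw [Finset.mem_sdiff] at ho
  obtain ⟨a, ha, hao⟩ := h.exists_blue ho.1 ho.2
  have hm : (I.erase a).card = m := by
    rw [Finset.card_erase_of_mem ha]; omega
  let e := (I.erase a).equivFinOfCardEq hm
  have he : ∀ i, (e.symm i : V) ≠ a ∧ (e.symm i : V) ∈ I := fun i =>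
    Finset.mem_erase.1 (e.symm i).2
  have heq : ∀ x y, 2 ≤ w x y → w x y = 2 := fun x y h => le_antisymm (hle2 x y) h
  refine ⟨a, o, fun i => e.symm i, fun i j hij => ?_, fun i => ?_, fun i => ?_, ?_⟩
  · refine heq _ _ (hI2 _ (he i).2 _ (he j).2 fun h => hij ?_)
    exact e.symm.injective (Subtype.ext h)
  · exact heq _ _ (hI2 _ ha _ (he i).2 (he i).1.symm)
  · rw [hsymm]
    refine heq _ _ (not_lt.1 fun hlt => ?_)
    exact (he i).1 (h.blue_unique ho.1 ho.2 (he i).2 ha (Nat.le_of_lt_succ hlt) hao)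
  · exact hS a (hIS ha) o ho.1 (ne_of_mem_of_not_mem ha ho.2)

/-- The number of units of weight missing between `x` and `A`. -/
def defect {V : Type*} (w : V → V → ℕ) (x : V) (A : Finset V) : ℕ := ∑ y ∈ A, (2 - w x y)

section defect

variable {V : Type*} {w : V → V → ℕ} {x : V} {A B C : Finset V}

theorem defect_mono (h : A ⊆ B) : defect w x A ≤ defect w x B :=
  Finset.sum_le_sum_of_subset h

theorem defect_add_le [DecidableEq V] (hAB : Disjoint A B) (hA : A ⊆ C) (hB : B ⊆ C) :
    defect w x A + defect w x B ≤ defect w x C := by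
  rw [defect, defect, ← Finset.sum_union hAB]
  exact Finset.sum_le_sum_of_subset (Finset.union_subset hA hB)

theorem card_filter_ne_two_le : (A.filter fun y => ¬ 2 ≤ w x y).card ≤ defect w x A := by
  rw [Finset.card_eq_sum_ones]
  exact (Finset.sum_le_sum fun y hy => by
    have := (Finset.mem_filter.1 hy).2; omega).trans (defect_mono (Finset.filter_subset _ _))

theorem two_mul_card_filter_le : 2 * (A.filter fun y => ¬ 1 ≤ w x y).card ≤ defect w x A := by
  rw [mul_comm, ← smul_eq_mul, ← Finset.sum_const]
  exact (Finset.sum_le_sum fun y hy => by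
    have := (Finset.mem_filter.1 hy).2; omega).trans (defect_mono (Finset.filter_subset _ _))

theorem two_mul_card_le_defect (h : ∀ y ∈ A, w x y = 0) : 2 * A.card ≤ defect w x A := by
  rw [mul_comm, ← smul_eq_mul, ← Finset.sum_const]
  exact Finset.sum_le_sum fun y hy => by rw [h y hy]

theorem card_le_defect (h : ∀ y ∈ A, w x y ≠ 2) (hle : ∀ y, w x y ≤ 2) :
    A.card ≤ defect w x A := by
  rw [Finset.card_eq_sum_ones]
  exact Finset.sum_le_sum fun y hy => by have := h y hy; have := hle y; omega
theorem card_le_card_filter_and (A : Finset V) (P Q : V → Prop) [DecidablePred P]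
    [DecidablePred Q] :
    A.card ≤ (A.filter fun x => P x ∧ Q x).card + (A.filter fun x => ¬ P x).card
      + (A.filter fun x => ¬ Q x).card := by
  classical
  refine le_trans (Finset.card_le_card fun x hx => ?_)
    ((Finset.card_union_le _ _).trans (Nat.add_le_add_right (Finset.card_union_le _ _) _))
  by_cases hP : P x <;> by_cases hQ : Q x <;> simp [hx, hP, hQ]

end defect

/-- The vertices `v i` are pairwise joined in red. -/
def IsRedClique {V ι : Type*} (w : V → V → ℕ) (v : ι → V) : Prop :=
  ∀ i j, i ≠ j → w (v i) (v j) = 2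

/-- The local structure of a dense `𝓕_{2m+4}`-free coloured graph on `(7m+9)η` vertices. -/
structure IsDense {V : Type*} [Fintype V] (w : V → V → ℕ) (m : ℕ) (η : ℝ) : Prop where
  symm : ∀ x y, w x y = w y x
  le_two : ∀ x y, w x y ≤ 2
  diag : ∀ x, w x x = 0
  ne_two : ∀ {p q : V} {v : Fin m → V}, IsRedClique w v → (∀ i, w p (v i) = 2) →
    (∀ i, w q (v i) = 2) → w p q ≠ 2
  eq_zero : ∀ {p q s : V} {v : Fin m → V}, IsRedClique w v → (∀ i, w p (v i) = 2) →
    (∀ i, 1 ≤ w q (v i)) → (∀ i, 1 ≤ w s (v i)) → 1 ≤ w p q → 1 ≤ w p s → w q s = 0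
  m_pos : 1 ≤ m
  pos : 0 < η
  card : (Fintype.card V : ℝ) = (7 * m + 9) * η
  defect_lt : ∀ x, (defect w x Finset.univ : ℝ) < 14 * η

/-- A copy of `RK_{m+2}^-`: the vertices `v i`, `u`, `u'` are joined in red, except that `u` and
`u'` may be joined in blue. -/
structure IsMinusClique {V : Type*} {m : ℕ} (w : V → V → ℕ) (u u' : V) (v : Fin m → V) : Prop where
  red : IsRedClique w v
  left : ∀ i, w u (v i) = 2
  right : ∀ i, w u' (v i) = 2
  adj : 1 ≤ w u u'

theorem IsRedClique.update {V ι : Type*} [DecidableEq ι] {w : V → V → ℕ}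
    (hsymm : ∀ x y, w x y = w y x) {v : ι → V} (hv : IsRedClique w v) {j : ι} {x : V}
    (hx : ∀ i, i ≠ j → w x (v i) = 2) : IsRedClique w (Function.update v j x) := by
  intro a b hab
  by_cases ha : a = j
  · subst ha
    rw [Function.update_self, Function.update_of_ne hab.symm]
    exact hx b hab.symm
  · rw [Function.update_of_ne ha]
    by_cases hb : b = j
    · subst hb
      rw [Function.update_self, hsymm]
      exact hx a ha
    · rw [Function.update_of_ne hb]
      exact hv a b hab

theorem forall_update {V ι : Type*} [DecidableEq ι] {P : V → Prop} {v : ι → V} {j : ι} {x : V}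
    (hx : P x) (hv : ∀ i, i ≠ j → P (v i)) (i : ι) : P (Function.update v j x i) := by
  by_cases hi : i = j
  · subst hi; rwa [Function.update_self]
  · rw [Function.update_of_ne hi]; exact hv i hi

theorem IsRedClique.injective {V ι : Type*} {w : V → V → ℕ} (hdiag : ∀ x, w x x = 0) {v : ι → V}
    (hv : IsRedClique w v) : Function.Injective v := by
  intro i j hij
  by_contra hne
  have := hv i j hne
  rw [hij, hdiag] at this
  omega

section IsDense

variable {V : Type*} [Fintype V] {w : V → V → ℕ} {m : ℕ} {η : ℝ}

theorem IsMinusClique.symm (hw : IsDense w m η) {u u' : V} {v : Fin m → V}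
    (hK : IsMinusClique w u u' v) : IsMinusClique w u' u v :=
  ⟨hK.red, hK.right, hK.left, hw.symm u u' ▸ hK.adj⟩

theorem IsDense.not_attach (hw : IsDense w m η) {u u' y : V} {v : Fin m → V}
    (hK : IsMinusClique w u u' v) {j : Fin m} (hyu' : w y u' = 2) (hyj : w y (v j) = 1)
    (hyv : ∀ k, k ≠ j → w y (v k) = 2) : False := by
  classical
  have hred : IsRedClique w (Function.update v j u') :=
    hK.red.update hw.symm fun i _ => hK.right i
  have hF : ∀ z, 14 ≤ 2 * (2 - w y z) + 2 * (2 - w u z) + 6 * (2 - w u' z) + 6 * (2 - w (v j) z)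
      + 7 * ∑ k ∈ Finset.univ.erase j, (2 - w (v k) z) := by
    intro z
    have hsum : ∀ k, k ≠ j → 2 - w (v k) z ≤ ∑ k ∈ Finset.univ.erase j, (2 - w (v k) z) :=
      fun k hk => Finset.single_le_sum (f := fun k => 2 - w (v k) z) (fun _ _ => Nat.zero_le _)
        (Finset.mem_erase.2 ⟨hk, Finset.mem_univ _⟩)
    by_contra! hlt
    have hv1 : ∀ k, k ≠ j → 1 ≤ w (v k) z := by
      intro k hk
      have := hsum k hk
      omega
    have hall : (∀ k, k ≠ j → w (v k) z = 2) ∨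
        1 ≤ ∑ k ∈ Finset.univ.erase j, (2 - w (v k) z) := by
      by_cases h : ∀ k, k ≠ j → w (v k) z = 2
      · exact Or.inl h
      · push Not at h
        obtain ⟨k, hk, hne⟩ := h
        have h1 := hsum k hk
        have h2 := hw.le_two (v k) z
        exact Or.inr (by omega)
    have hle := hw.le_two
    have hu'1 : 1 ≤ w u' z := by
      by_contra h0
      rcases hall with hall | hall
      · have : w (v j) z = 2 → w z u ≠ 2 := fun h => hw.ne_two hK.red (fun i => by
          by_cases hi : i = j
          · subst hi; rw [hw.symm, h]
          · rw [hw.symm, hall i hi]) hK.left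
        rw [hw.symm z u] at this
        have h1 := hle (v j) z
        have h2 := hle u z
        omega
      · omega
    have hj1 : 1 ≤ w (v j) z := by
      by_contra h0
      rcases hall with hall | hall
      · have : w u' z = 2 → w z y ≠ 2 := fun h => hw.ne_two hred
          (forall_update (P := fun x => w z x = 2) (by rw [hw.symm, h])
            fun i hi => by rw [hw.symm, hall i hi])
          (forall_update (P := fun x => w y x = 2) hyu' hyv)
        rw [hw.symm z y] at this
        have h1 := hle u' z
        have h2 := hle y z
        omega
      · omega
    have hv1' : ∀ k, 1 ≤ w z (v k) := fun k => by
      rw [hw.symm]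
      by_cases hk : k = j
      · rw [hk]; exact hj1
      · exact hv1 k hk
    have hu0 : w u z = 0 := by
      by_contra h0
      have := hw.eq_zero hK.red hK.left (fun i => by rw [hK.right i]; norm_num) hv1' hK.adj
        (Nat.one_le_iff_ne_zero.2 h0)
      omega
    have hy0 : w y z = 0 := by
      by_contra h0
      have := hw.eq_zero (p := u') (q := y) (s := z) hK.red hK.right (fun i => by
          by_cases hi : i = j
          · rw [hi, hyj]
          · rw [hyv i hi]; norm_num) hv1' (by rw [hw.symm, hyu']; norm_num) hu'1
      omega
    rcases hall with hall | hall
    · have : w (v j) z = 2 → w z u' ≠ 2 := fun h => hw.ne_two hK.red (fun i => by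
          by_cases hi : i = j
          · subst hi; rw [hw.symm, h]
          · rw [hw.symm, hall i hi]) hK.right
      rw [hw.symm z u'] at this
      have h1 := hle (v j) z
      have h2 := hle u' z
      omega
    · omega
  have hsum : 14 * Fintype.card V ≤ 2 * defect w y Finset.univ + 2 * defect w u Finset.univ
      + 6 * defect w u' Finset.univ + 6 * defect w (v j) Finset.univ
      + 7 * ∑ k ∈ Finset.univ.erase j, defect w (v k) Finset.univ := by
    calc 14 * Fintype.card V = ∑ _z : V, 14 := by simp [mul_comm]
      _ ≤ _ := Finset.sum_le_sum fun z _ => hF z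
      _ = _ := by
        simp only [Finset.sum_add_distrib, ← Finset.mul_sum, defect]
        rw [Finset.sum_comm]
  have hsum' : 14 * (Fintype.card V : ℝ) ≤ 2 * defect w y Finset.univ
      + 2 * defect w u Finset.univ + 6 * defect w u' Finset.univ + 6 * defect w (v j) Finset.univ
      + 7 * ∑ k ∈ Finset.univ.erase j, (defect w (v k) Finset.univ : ℝ) := by exact_mod_cast hsum
  have hrest : ∑ k ∈ Finset.univ.erase j, (defect w (v k) Finset.univ : ℝ)
      ≤ ∑ _k ∈ Finset.univ.erase j, 14 * η := Finset.sum_le_sum fun k _ => (hw.defect_lt _).le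
  rw [Finset.sum_const, Finset.card_erase_of_mem (Finset.mem_univ _), Finset.card_univ,
    Fintype.card_fin, nsmul_eq_mul, Nat.cast_sub hw.m_pos, Nat.cast_one] at hrest
  rw [hw.card] at hsum'
  have h1 := hw.defect_lt y
  have h2 := hw.defect_lt u
  have h3 := hw.defect_lt u'
  have h4 := hw.defect_lt (v j)
  nlinarith

/-- The weighted defect of a vertex with respect to a copy of `RK_{m+2}^-`. -/
def excess (w : V → V → ℕ) (u u' : V) (v : Fin m → V) (z : V) : ℕ :=
  2 * (2 - w u z) + 2 * (2 - w u' z) + 3 * ∑ i, (2 - w (v i) z)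

/-- The vertex `z` could replace the vertex `v j` of a copy of `RK_{m+2}^-`. -/
structure IsTwin (w : V → V → ℕ) (u u' : V) (v : Fin m → V) (j : Fin m) (z : V) : Prop where
  eq_zero : w z (v j) = 0
  red : ∀ i, i ≠ j → w z (v i) = 2
  left : 1 ≤ w u z
  right : 1 ≤ w u' z
  or_red : w u z = 2 ∨ w u' z = 2

theorem IsMinusClique.excess_ge_nine (hw : IsDense w m η) {u u' : V} {v : Fin m → V}
    (hK : IsMinusClique w u u' v) {z : V} (hz : ¬ ∀ i, w z (v i) = 2)
    (hz' : ∀ j, ¬ IsTwin w u u' v j z) : 9 ≤ excess w u u' v z := by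
  classical
  by_contra! hlt
  unfold excess at hlt
  have hle := hw.le_two
  have hsplit : ∀ j, ∑ i, (2 - w (v i) z)
      = (2 - w (v j) z) + ∑ i ∈ Finset.univ.erase j, (2 - w (v i) z) := fun j =>
    (Finset.add_sum_erase _ _ (Finset.mem_univ j)).symm
  have hrest : ∀ j, ∑ i ∈ Finset.univ.erase j, (2 - w (v i) z) = 0 →
      ∀ i, i ≠ j → w z (v i) = 2 := by
    intro j h i hi
    have := Finset.sum_eq_zero_iff.1 h i (Finset.mem_erase.2 ⟨hi, Finset.mem_univ _⟩)
    rw [hw.symm]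
    have := hle (v i) z
    omega
  by_cases hadj : ∀ i, 1 ≤ w z (v i)
  · have hnadj : w u z = 0 ∨ w u' z = 0 := by
      by_contra! h
      have := hw.eq_zero hK.red hK.left (fun i => by rw [hK.right i]; norm_num) hadj hK.adj
        (Nat.one_le_iff_ne_zero.2 h.1)
      exact h.2 this
    push Not at hz
    obtain ⟨j, hj⟩ := hz
    have h1 := hsplit j
    have h2 := hle z (v j)
    have h3 := hadj j
    have h4 := hle u z
    have h5 := hle u' z
    rw [hw.symm (v j) z] at h1
    have h6 := hrest j (by omega)
    rcases hnadj with h | h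
    · exact hw.not_attach hK (j := j) (y := z) (by rw [hw.symm]; omega)
        (by omega) h6
    · exact hw.not_attach (hK.symm hw) (j := j) (y := z) (by rw [hw.symm]; omega) (by omega) h6
  · push Not at hadj
    obtain ⟨j, hj⟩ := hadj
    have h1 := hsplit j
    have h4 := hle u z
    have h5 := hle u' z
    rw [hw.symm (v j) z] at h1
    have h6 := hrest j (by omega)
    exact hz' j ⟨by omega, h6, by omega, by omega, by omega⟩

theorem IsMinusClique.excess_ge_six (hw : IsDense w m η) {u u' : V} {v : Fin m → V}
    (hK : IsMinusClique w u u' v) (z : V) : 6 ≤ excess w u u' v z := by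
  by_cases hz : ∀ i, w z (v i) = 2
  · have h1 := hw.ne_two hK.red hz hK.left
    have h2 := hw.ne_two hK.red hz hK.right
    rw [hw.symm] at h1 h2
    have h3 : 1 ≤ w u z → w u' z = 0 := fun h =>
      hw.eq_zero hK.red hK.left (fun i => by rw [hK.right i]; norm_num)
        (fun i => by rw [hz i]; norm_num) hK.adj h
    have h4 := hw.le_two u z
    have h5 := hw.le_two u' z
    unfold excess
    omega
  by_cases hz' : ∃ j, IsTwin w u u' v j z
  · obtain ⟨j, hj⟩ := hz'
    have h := hj.eq_zero
    have hsum : 2 - w (v j) z ≤ ∑ i, (2 - w (v i) z) :=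
      Finset.single_le_sum (f := fun k => 2 - w (v k) z) (fun _ _ => Nat.zero_le _)
        (Finset.mem_univ j)
    rw [hw.symm] at h
    unfold excess
    omega
  · push Not at hz'
    exact le_trans (by norm_num) (hK.excess_ge_nine hw hz hz')

theorem IsMinusClique.card_mul_lt (hw : IsDense w m η) {u u' : V} {v : Fin m → V}
    (hK : IsMinusClique w u u' v) {A : Finset V} {k : ℕ}
    (hA : ∀ z ∈ A, 6 + k ≤ excess w u u' v z) : (k : ℝ) * A.card < 2 * η := by
  classical
  have hsum : 6 * Fintype.card V + k * A.card ≤ 2 * defect w u Finset.univ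
      + 2 * defect w u' Finset.univ + 3 * ∑ i, defect w (v i) Finset.univ := by
    calc 6 * Fintype.card V + k * A.card
        = ∑ z : V, (6 + if z ∈ A then k else 0) := by
          rw [Finset.sum_add_distrib, Finset.sum_ite_mem]; simp [mul_comm]
      _ ≤ ∑ z, excess w u u' v z := Finset.sum_le_sum fun z _ => by
          split_ifs with h
          · exact hA z h
          · exact hK.excess_ge_six hw z
      _ = _ := by
          simp only [excess, Finset.sum_add_distrib, ← Finset.mul_sum, defect]
          rw [Finset.sum_comm]
  have hsum' : 6 * (Fintype.card V : ℝ) + k * A.card ≤ 2 * defect w u Finset.univ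
      + 2 * defect w u' Finset.univ + 3 * ∑ i, (defect w (v i) Finset.univ : ℝ) := by
    exact_mod_cast hsum
  have hrest : ∑ i, (defect w (v i) Finset.univ : ℝ) ≤ ∑ _i : Fin m, 14 * η :=
    Finset.sum_le_sum fun k _ => (hw.defect_lt _).le
  rw [Finset.sum_const, Finset.card_univ, Fintype.card_fin, nsmul_eq_mul] at hrest
  rw [hw.card] at hsum'
  have h1 := hw.defect_lt u
  have h2 := hw.defect_lt u'
  linarith

/-- A partial partition of the vertices: `some none` is the class `Z` which will be split in two,
`some (some j)` is the `j`-th independent class and `none` is unassigned. -/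
structure IsFrame (w : V → V → ℕ) (c : V → Option (Option (Fin m))) : Prop where
  indep : ∀ j x y, c x = some (some j) → c y = some (some j) → w x y = 0
  ne_two : ∀ x y, c x = some none → c y = some none → w x y ≠ 2
  eq_zero : ∀ x y z, c x = some none → c y = some none → c z = some none →
    1 ≤ w x y → 1 ≤ w x z → w y z = 0

/-- The class of a partial partition with a given label. -/
def cls (c : V → Option (Option (Fin m))) (a : Option (Option (Fin m))) : Finset V :=
  Finset.univ.filter fun x => c x = a

theorem mem_cls {c : V → Option (Option (Fin m))} {a : Option (Option (Fin m))} {x : V} :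
    x ∈ cls c a ↔ c x = a := by simp [cls]

theorem cls_disjoint (c : V → Option (Option (Fin m))) {a b : Option (Option (Fin m))}
    (h : a ≠ b) : Disjoint (cls c a) (cls c b) :=
  Finset.disjoint_left.2 fun _ ha hb => h ((mem_cls.1 ha).symm.trans (mem_cls.1 hb))

theorem IsTwin.w_eq_zero (hw : IsDense w m η) {u u' : V} {v : Fin m → V}
    (hK : IsMinusClique w u u' v) {j : Fin m} {x y : V} (hx : IsTwin w u u' v j x)
    (hyv : ∀ i, i ≠ j → 1 ≤ w y (v i)) (hyu : 1 ≤ w u y) (hyu' : 1 ≤ w u' y) : w x y = 0 := by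
  classical
  by_contra h
  have hred : IsRedClique w (Function.update v j x) := hK.red.update hw.symm hx.red
  have hy : ∀ i, 1 ≤ w y (Function.update v j x i) :=
    forall_update (P := fun z => 1 ≤ w y z) (by rw [hw.symm]; omega) hyv
  have hu : ∀ i, 1 ≤ w u (Function.update v j x i) :=
    forall_update (P := fun z => 1 ≤ w u z) hx.left fun i _ => by rw [hK.left i]; norm_num
  have hu' : ∀ i, 1 ≤ w u' (Function.update v j x i) :=
    forall_update (P := fun z => 1 ≤ w u' z) hx.right fun i _ => by rw [hK.right i]; norm_num
  rcases hx.or_red with h2 | h2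
  · have := hw.eq_zero hred (forall_update (P := fun z => w u z = 2) h2 fun i _ => hK.left i)
      hu' hy hK.adj hyu
    omega
  · have := hw.eq_zero hred (forall_update (P := fun z => w u' z = 2) h2 fun i _ => hK.right i)
      hu hy (hK.symm hw).adj hyu'
    omega

theorem IsMinusClique.exists_frame (hw : IsDense w m η) {u u' : V} {v : Fin m → V}
    (hK : IsMinusClique w u u' v) :
    ∃ c : V → Option (Option (Fin m)), IsFrame w c ∧ 3 * ((cls c none).card : ℝ) < 2 * η := by
  classical
  let c : V → Option (Option (Fin m)) := fun z =>
    if ∀ i, w z (v i) = 2 then some none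
    else if h : ∃ j, IsTwin w u u' v j z then some (some h.choose) else none
  have hZ : ∀ z, c z = some none → ∀ i, w z (v i) = 2 := by
    intro z hz
    simp only [c] at hz
    split_ifs at hz with h1 h2
    · exact h1
    · simp at hz
  have hW : ∀ z j, c z = some (some j) → IsTwin w u u' v j z := by
    intro z j hz
    simp only [c] at hz
    split_ifs at hz with h1 h2
    · simp at hz
    · simp only [Option.some.injEq] at hz
      exact hz ▸ h2.choose_spec
  have hE : ∀ z, c z = none → 9 ≤ excess w u u' v z := by
    intro z hz
    simp only [c] at hz
    split_ifs at hz with h1 h2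
    exact hK.excess_ge_nine hw h1 (not_exists.1 h2)
  refine ⟨c, ⟨fun j x y hx hy => ?_, fun x y hx hy => ?_, fun x y z hx hy hz hxy hxz => ?_⟩, ?_⟩
  · have hy' := hW y j hy
    exact (hW x j hx).w_eq_zero hw hK (fun i hi => by rw [hy'.red i hi]; norm_num) hy'.left
      hy'.right
  · exact hw.ne_two hK.red (hZ x hx) (hZ y hy)
  · exact hw.eq_zero hK.red (hZ x hx) (fun i => by rw [hZ y hy i]; norm_num)
      (fun i => by rw [hZ z hz i]; norm_num) hxy hxz
  · exact_mod_cast hK.card_mul_lt hw (k := 3) fun z hz => hE z (mem_cls.1 hz)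

/-- The missing size of the `j`-th independent class. -/
def slack (c : V → Option (Option (Fin m))) (η : ℝ) (j : Fin m) : ℝ :=
  7 * η - (cls c (some (some j))).card

theorem IsFrame.slack_nonneg (hw : IsDense w m η) {c : V → Option (Option (Fin m))}
    (hc : IsFrame w c) (j : Fin m) : 0 ≤ slack c η j := by
  unfold slack
  rcases (cls c (some (some j))).eq_empty_or_nonempty with h | ⟨x, hx⟩
  · rw [h]; have := hw.pos; simp; linarith
  · have h1 : 2 * (cls c (some (some j))).card ≤ defect w x Finset.univ :=
      (two_mul_card_le_defect fun y hy => hc.indep j x y (mem_cls.1 hx) (mem_cls.1 hy)).trans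
        (defect_mono (Finset.subset_univ _))
    have h2 := hw.defect_lt x
    have h3 : (2 * (cls c (some (some j))).card : ℝ) ≤ defect w x Finset.univ := by
      exact_mod_cast h1
    linarith

theorem IsFrame.slack_le (hw : IsDense w m η) {c : V → Option (Option (Fin m))}
    (hc : IsFrame w c) (j : Fin m) : slack c η j ≤ ∑ i, slack c η i :=
  Finset.single_le_sum (fun i _ => hc.slack_nonneg hw i) (Finset.mem_univ j)

theorem IsFrame.slack_add_le (hw : IsDense w m η) {c : V → Option (Option (Fin m))}
    (hc : IsFrame w c) {i j : Fin m} (hij : i ≠ j) :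
    slack c η i + slack c η j ≤ ∑ i, slack c η i := by
  classical
  rw [← Finset.sum_pair hij]
  exact Finset.sum_le_sum_of_subset_of_nonneg (Finset.subset_univ _)
    fun i _ _ => hc.slack_nonneg hw i

theorem sum_slack (hw : IsDense w m η) (c : V → Option (Option (Fin m))) :
    ∑ i, slack c η i = (cls c (some none)).card + (cls c none).card - 9 * η := by
  classical
  have h : Fintype.card V = ∑ a, (cls c a).card := by
    rw [← Finset.card_univ]
    exact Finset.card_eq_sum_card_fiberwise fun _ _ => Finset.mem_coe.2 (Finset.mem_univ _)
  rw [Fintype.sum_option, Fintype.sum_option] at h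
  have h' : (Fintype.card V : ℝ) = (cls c none).card + ((cls c (some none)).card
      + ∑ i, ((cls c (some (some i))).card : ℝ)) := by exact_mod_cast h
  rw [hw.card] at h'
  simp only [slack, Finset.sum_sub_distrib, Finset.sum_const, Finset.card_univ, Fintype.card_fin,
    nsmul_eq_mul]
  linarith

/-- The defect of an element of an independent class outside that class is small. -/
theorem IsFrame.defect_compl_lt [DecidableEq V] (hw : IsDense w m η)
    {c : V → Option (Option (Fin m))} (hc : IsFrame w c) {j : Fin m} {x : V}
    (hx : c x = some (some j)) :
    (defect w x (Finset.univ \ cls c (some (some j))) : ℝ) < 2 * slack c η j := by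
  have h1 := two_mul_card_le_defect (w := w) fun y hy => hc.indep j x y hx (mem_cls.1 hy)
  have h2 := defect_add_le (w := w) (x := x) (Finset.disjoint_sdiff (s := cls c (some (some j)))
    (t := Finset.univ)) (Finset.subset_univ _) (Finset.subset_univ _)
  have h3 := hw.defect_lt x
  have h4 : (2 * (cls c (some (some j))).card
      + defect w x (Finset.univ \ cls c (some (some j))) : ℝ) ≤ defect w x Finset.univ := by
    exact_mod_cast (Nat.add_le_add_right h1 _).trans h2
  unfold slack
  linarith

/-- The defect of two adjacent elements of `Z` outside `Z` is small. -/
theorem IsFrame.defect_add_defect_lt [DecidableEq V] (hw : IsDense w m η)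
    {c : V → Option (Option (Fin m))} (hc : IsFrame w c) {u u' : V} (hu : c u = some none)
    (hu' : c u' = some none) (huu : 1 ≤ w u u') :
    (defect w u (Finset.univ \ cls c (some none)) : ℝ)
      + defect w u' (Finset.univ \ cls c (some none)) < 28 * η - 3 * (cls c (some none)).card := by
  set Z := cls c (some none) with hZ
  have h1 : 3 * Z.card ≤ defect w u Z + defect w u' Z := by
    rw [defect, defect, ← Finset.sum_add_distrib, mul_comm, ← smul_eq_mul, ← Finset.sum_const]
    refine Finset.sum_le_sum fun y hy => ?_
    have hy' := mem_cls.1 hy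
    have h1 := hc.ne_two u y hu hy'
    have h2 := hc.ne_two u' y hu' hy'
    have h3 := hw.le_two u y
    have h4 := hw.le_two u' y
    have h5 := hc.eq_zero u u' y hu hu' hy' huu
    omega
  have h2 := defect_add_le (w := w) (x := u) (Finset.disjoint_sdiff (s := Z)
    (t := Finset.univ)) (Finset.subset_univ _) (Finset.subset_univ _)
  have h3 := defect_add_le (w := w) (x := u') (Finset.disjoint_sdiff (s := Z)
    (t := Finset.univ)) (Finset.subset_univ _) (Finset.subset_univ _)
  have h4 := hw.defect_lt u
  have h5 := hw.defect_lt u'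
  have h6 : (3 * Z.card + (defect w u (Finset.univ \ Z) + defect w u' (Finset.univ \ Z)) : ℝ)
      ≤ defect w u Finset.univ + defect w u' Finset.univ := by
    exact_mod_cast (by omega : 3 * Z.card + (defect w u (Finset.univ \ Z)
      + defect w u' (Finset.univ \ Z)) ≤ defect w u Finset.univ + defect w u' Finset.univ)
  linarith

/-- A large subset of `Z` spans an edge. -/
theorem IsFrame.exists_adj (hw : IsDense w m η) {c : V → Option (Option (Fin m))}
    (hc : IsFrame w c) {A : Finset V} (hA : A ⊆ cls c (some none)) (hne : A.Nonempty)
    (hcard : 14 * η ≤ (cls c (some none)).card + A.card) : ∃ p ∈ A, ∃ q ∈ A, 1 ≤ w p q := by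
  classical
  by_contra! h
  obtain ⟨x, hx⟩ := hne
  set Z := cls c (some none) with hZ
  have h1 : 2 * A.card ≤ defect w x A :=
    two_mul_card_le_defect fun y hy => by have := h x hx y hy; omega
  have h2 : (Z \ A).card ≤ defect w x (Z \ A) :=
    card_le_defect (fun y hy => hc.ne_two x y (mem_cls.1 (hA hx))
      (mem_cls.1 (Finset.mem_sdiff.1 hy).1)) (hw.le_two x)
  have h3 := defect_add_le (w := w) (x := x) (Finset.disjoint_sdiff (s := A)
    (t := Z)) (Finset.subset_univ _) (Finset.subset_univ _)
  have h4 := hw.defect_lt x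
  have h5 := Finset.card_sdiff_add_card_eq_card hA
  have h6 : (Z.card + A.card : ℝ) ≤ defect w x Finset.univ := by
    exact_mod_cast (by omega : Z.card + A.card ≤ defect w x Finset.univ)
  linarith

theorem IsFrame.three_mul_card_lt (hw : IsDense w m η) {c : V → Option (Option (Fin m))}
    (hc : IsFrame w c) : 3 * ((cls c (some none)).card : ℝ) < 28 * η := by
  classical
  have hpos := hw.pos
  rcases (cls c (some none)).eq_empty_or_nonempty with h | h
  · rw [h]; simp; linarith
  by_contra! hlt
  obtain ⟨p, hp, q, hq, hpq⟩ := hc.exists_adj hw subset_rfl h (by linarith)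
  have h1 := hc.defect_add_defect_lt hw (mem_cls.1 hp) (mem_cls.1 hq) hpq
  have h2 : (0 : ℝ) ≤ defect w p (Finset.univ \ cls c (some none)) := Nat.cast_nonneg _
  have h3 : (0 : ℝ) ≤ defect w q (Finset.univ \ cls c (some none)) := Nat.cast_nonneg _
  linarith

/-- Large subsets of distinct independent classes have a red transversal. -/
theorem IsFrame.exists_transversal [Nonempty V] (hw : IsDense w m η)
    {c : V → Option (Option (Fin m))} (hc : IsFrame w c) (J : Finset (Fin m))
    (A : Fin m → Finset V) (hA : ∀ j ∈ J, A j ⊆ cls c (some (some j)))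
    (hcard : ∀ j ∈ J, 2 * ∑ i, slack c η i < (A j).card) :
    ∃ x : Fin m → V, (∀ j ∈ J, x j ∈ A j) ∧ ∀ i ∈ J, ∀ j ∈ J, i ≠ j → w (x i) (x j) = 2 := by
  classical
  induction J using Finset.induction_on with
  | empty => exact ⟨fun _ => Classical.arbitrary V, by simp, by simp⟩
  | insert a J ha ih =>
    obtain ⟨x, hx, hxx⟩ := ih (fun j hj => hA j (Finset.mem_insert_of_mem hj))
      fun j hj => hcard j (Finset.mem_insert_of_mem hj)
    have hAa := hA a (Finset.mem_insert_self _ _)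
    have hbad : ∀ i ∈ J, (((A a).filter fun y => ¬ 2 ≤ w (x i) y).card : ℝ)
        ≤ 2 * slack c η i := by
      intro i hi
      have hxi := mem_cls.1 (hA i (Finset.mem_insert_of_mem hi) (hx i hi))
      have h1 : A a ⊆ Finset.univ \ cls c (some (some i)) := fun y hy => by
        rw [Finset.mem_sdiff, mem_cls, mem_cls.1 (hAa hy)]
        refine ⟨Finset.mem_univ _, fun h => ha ?_⟩
        simp only [Option.some.injEq] at h
        exact h ▸ hi
      refine le_trans ?_ (hc.defect_compl_lt hw hxi).le
      exact_mod_cast card_filter_ne_two_le.trans (defect_mono h1)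
    obtain ⟨y, hy, hyx⟩ : ∃ y ∈ A a, ∀ i ∈ J, 2 ≤ w (x i) y := by
      by_contra! h
      have h1 : A a ⊆ J.biUnion fun i => (A a).filter fun y => ¬ 2 ≤ w (x i) y := fun y hy => by
        obtain ⟨i, hi, hlt⟩ := h y hy
        exact Finset.mem_biUnion.2 ⟨i, hi, Finset.mem_filter.2 ⟨hy, not_le.2 hlt⟩⟩
      have h2 : ((A a).card : ℝ)
          ≤ ∑ i ∈ J, (((A a).filter fun y => ¬ 2 ≤ w (x i) y).card : ℝ) := by
        exact_mod_cast (Finset.card_le_card h1).trans Finset.card_biUnion_le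
      have h3 : ∑ i ∈ J, 2 * slack c η i ≤ ∑ i, 2 * slack c η i :=
        Finset.sum_le_sum_of_subset_of_nonneg (Finset.subset_univ _)
          fun i _ _ => mul_nonneg (by norm_num) (hc.slack_nonneg hw i)
      rw [← Finset.mul_sum] at h3
      have h4 := Finset.sum_le_sum hbad
      have h5 := hcard a (Finset.mem_insert_self _ _)
      rw [← Finset.mul_sum] at h4
      rw [← Finset.mul_sum] at h3
      linarith
    have hne : ∀ i ∈ J, i ≠ a := fun i hi => ne_of_mem_of_not_mem hi ha
    have hyx' : ∀ i ∈ J, w (x i) y = 2 := fun i hi => le_antisymm (hw.le_two _ _) (hyx i hi)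
    refine ⟨Function.update x a y, fun j hj => ?_, fun i hi j hj hij => ?_⟩
    · rcases Finset.mem_insert.1 hj with rfl | hj
      · rwa [Function.update_self]
      · rw [Function.update_of_ne (hne j hj)]; exact hx j hj
    · rw [Finset.mem_insert] at hi hj
      rcases hi with rfl | hi <;> rcases hj with rfl | hj
      · exact absurd rfl hij
      · rw [Function.update_self, Function.update_of_ne (hne j hj), hw.symm]; exact hyx' j hj
      · rw [Function.update_self, Function.update_of_ne (hne i hi)]; exact hyx' i hi
      · rw [Function.update_of_ne (hne i hi), Function.update_of_ne (hne j hj)]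
        exact hxx i hi j hj hij

theorem cls_subset_sdiff [DecidableEq V] (c : V → Option (Option (Fin m)))
    {a b : Option (Option (Fin m))} (h : a ≠ b) : cls c a ⊆ Finset.univ \ cls c b :=
  Finset.subset_sdiff.2 ⟨Finset.subset_univ _, cls_disjoint c h⟩

/-- An unassigned vertex with a red neighbour in `Z` has two adjacent neighbours in `Z`. -/
theorem IsFrame.exists_adj_of_red (hw : IsDense w m η) {c : V → Option (Option (Fin m))}
    (hc : IsFrame w c) (he : 3 * ((cls c none).card : ℝ) < 2 * η) {y u : V}
    (hu : c u = some none) (hyu : w y u = 2) :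
    ∃ p q, c p = some none ∧ c q = some none ∧ 1 ≤ w y p ∧ 1 ≤ w y q ∧ 1 ≤ w p q := by
  classical
  by_contra! hind
  have : Nonempty V := ⟨y⟩
  have : Nonempty (Fin m) := ⟨⟨0, hw.m_pos⟩⟩
  have hpos := hw.pos
  set Z := cls c (some none) with hZ
  set N := Z.filter fun x => 1 ≤ w y x with hN
  set M := Z.filter fun x => ¬ 1 ≤ w y x with hM
  have hNM : N.card + M.card = Z.card := Finset.card_filter_add_card_filter_not _
  have hNMd : Disjoint N M := Finset.disjoint_filter_filter_not _ _ _
  have hy1 : 2 * M.card ≤ defect w y Z := two_mul_card_filter_le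
  have hu1 : 2 * N.card ≤ defect w u N := two_mul_card_le_defect fun x hx => by
    have hx := Finset.mem_filter.1 hx
    have := hind u x hu (mem_cls.1 hx.1) (by omega) hx.2
    omega
  have hu2 : M.card ≤ defect w u M := card_le_defect (fun x hx =>
    hc.ne_two u x hu (mem_cls.1 (Finset.mem_filter.1 hx).1)) (hw.le_two u)
  have hu3 := defect_add_le (w := w) (x := u) hNMd (Finset.filter_subset _ Z)
    (Finset.filter_subset _ Z)
  have hu4 := defect_add_le (w := w) (x := u) (Finset.disjoint_sdiff (s := Z)
    (t := Finset.univ)) (Finset.subset_univ _) (Finset.subset_univ _)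
  have hy4 := defect_add_le (w := w) (x := y) (Finset.disjoint_sdiff (s := Z)
    (t := Finset.univ)) (Finset.subset_univ _) (Finset.subset_univ _)
  have hu5 := hw.defect_lt u
  have hy5 := hw.defect_lt y
  have hu6 : (2 * N.card + M.card + defect w u (Finset.univ \ Z) : ℝ) < 14 * η :=
    lt_of_le_of_lt (by exact_mod_cast (by omega)) hu5
  have hy6 : (2 * M.card + defect w y (Finset.univ \ Z) : ℝ) < 14 * η :=
    lt_of_le_of_lt (by exact_mod_cast (by omega)) hy5
  have hNM' : (N.card + M.card : ℝ) = Z.card := by exact_mod_cast hNM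
  have hT := sum_slack hw c
  rw [← hZ] at hT
  have hZlt := hc.three_mul_card_lt hw
  rw [← hZ] at hZlt
  obtain ⟨k, -, hk⟩ := Finset.exists_max_image Finset.univ
    (fun j => defect w y (cls c (some (some j)))) Finset.univ_nonempty
  let A : Fin m → Finset V := fun j => (cls c (some (some j))).filter fun x =>
    (if j = k then 1 else 2) ≤ w y x ∧ 2 ≤ w u x
  have hA : ∀ j, 2 * ∑ i, slack c η i < (A j).card := by
    intro j
    have hWZ : ∀ i : Fin m, cls c (some (some i)) ⊆ Finset.univ \ Z := fun i =>
      cls_subset_sdiff c (by simp)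
    have h1 := card_le_card_filter_and (cls c (some (some j)))
      (fun x => (if j = k then 1 else 2) ≤ w y x) (fun x => 2 ≤ w u x)
    change _ ≤ (A j).card + _ + _ at h1
    have h2 : ((cls c (some (some j))).filter fun x => ¬ 2 ≤ w u x).card
        ≤ defect w u (Finset.univ \ Z) := card_filter_ne_two_le.trans (defect_mono (hWZ j))
    have h3 : 2 * ((cls c (some (some j))).filter
        fun x => ¬ (if j = k then 1 else 2) ≤ w y x).card ≤ defect w y (Finset.univ \ Z) := by
      by_cases hjk : j = k
      · simp only [hjk, if_true]
        exact two_mul_card_filter_le.trans (defect_mono (hWZ k))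
      · simp only [hjk, if_false]
        have h4 := defect_add_le (w := w) (x := y)
          (cls_disjoint c (a := some (some j)) (b := some (some k)) (by simpa using hjk))
          (hWZ j) (hWZ k)
        have h5 := hk j (Finset.mem_univ j)
        have h6 : ((cls c (some (some j))).filter fun x => ¬ 2 ≤ w y x).card
          ≤ defect w y (cls c (some (some j))) := card_filter_ne_two_le
        omega
    have h4 : (2 * (cls c (some (some j))).card : ℝ) ≤ 2 * (A j).card
        + defect w y (Finset.univ \ Z) + 2 * defect w u (Finset.univ \ Z) := by
      exact_mod_cast (by omega : 2 * (cls c (some (some j))).card ≤ 2 * (A j).card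
        + defect w y (Finset.univ \ Z) + 2 * defect w u (Finset.univ \ Z))
    have h5 := hc.slack_le hw j
    have h6 : ((cls c (some (some j))).card : ℝ) = 7 * η - slack c η j := by unfold slack; ring
    linarith
  obtain ⟨x, hxA, hx⟩ := hc.exists_transversal hw Finset.univ A
    (fun j _ => Finset.filter_subset _ _) fun j _ => hA j
  have hx' : IsRedClique w x := fun i j => hx i (Finset.mem_univ i) j (Finset.mem_univ j)
  have hux : ∀ i, w u (x i) = 2 := fun i => le_antisymm (hw.le_two _ _)
    (Finset.mem_filter.1 (hxA i (Finset.mem_univ i))).2.2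
  have hyx : ∀ i, i ≠ k → w y (x i) = 2 := fun i hi => le_antisymm (hw.le_two _ _) (by
    simpa [hi] using (Finset.mem_filter.1 (hxA i (Finset.mem_univ i))).2.1)
  have hyk : 1 ≤ w y (x k) := by
    simpa using (Finset.mem_filter.1 (hxA k (Finset.mem_univ k))).2.1
  have hK : IsMinusClique w y (x k) (Function.update x k u) :=
    { red := hx'.update hw.symm fun i _ => hux i
      left := forall_update (P := fun z => w y z = 2) hyu hyx
      right := forall_update (P := fun z => w (x k) z = 2) (by rw [hw.symm]; exact hux k)
        fun i hi => hx' k i hi.symm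
      adj := hyk }
  have hM2 := hK.card_mul_lt hw (A := M) (k := 1) fun z hz => by
    have hz := Finset.mem_filter.1 hz
    have h1 := hc.ne_two u z hu (mem_cls.1 hz.1)
    have h2 := hw.le_two u z
    have h3 : 2 - w (Function.update x k u k) z ≤ ∑ i, (2 - w (Function.update x k u i) z) :=
      Finset.single_le_sum (f := fun i => 2 - w (Function.update x k u i) z)
        (fun _ _ => Nat.zero_le _) (Finset.mem_univ k)
    rw [Function.update_self] at h3
    unfold excess
    omega
  have hT0 := Finset.sum_nonneg fun i (_ : i ∈ Finset.univ) => hc.slack_nonneg hw i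
  have := Nat.cast_nonneg (α := ℝ) (defect w u (Finset.univ \ Z))
  push_cast at hM2
  linarith

/-- No vertex has two adjacent neighbours in `Z` and a neighbour in every other class. -/
theorem IsFrame.eq_zero_of_nbr (hw : IsDense w m η) {c : V → Option (Option (Fin m))}
    (hc : IsFrame w c) (he : 3 * ((cls c none).card : ℝ) < 2 * η) {y u u' : V}
    (hy : ∀ j, ∃ x, c x = some (some j) ∧ 1 ≤ w y x)
    (hu : c u = some none) (hu' : c u' = some none) (hyu : 1 ≤ w y u) (hyu' : 1 ≤ w y u') :
    w u u' = 0 := by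
  classical
  by_contra huu
  replace huu : 1 ≤ w u u' := Nat.one_le_iff_ne_zero.2 huu
  have : Nonempty V := ⟨y⟩
  have : Nonempty (Fin m) := ⟨⟨0, hw.m_pos⟩⟩
  have hpos := hw.pos
  have hT := sum_slack hw c
  have hZlt := hc.three_mul_card_lt hw
  have huu' := hc.defect_add_defect_lt hw hu hu' huu
  set Z := cls c (some none) with hZ
  have hWZ : ∀ i : Fin m, cls c (some (some i)) ⊆ Finset.univ \ Z := fun i =>
    cls_subset_sdiff c (by simp)
  have hcls : ∀ j, ((cls c (some (some j))).card : ℝ) = 7 * η - slack c η j := fun j => by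
    unfold slack; ring
  have hT0 := Finset.sum_nonneg fun i (_ : i ∈ Finset.univ) => hc.slack_nonneg hw i
  have hyη := hw.defect_lt y
  obtain ⟨k, -, hk⟩ := Finset.exists_max_image Finset.univ
    (fun j => defect w y (cls c (some (some j)))) Finset.univ_nonempty
  -- a copy of `RK_{m+2}^-` on `u`, `u'` and neighbours of `y` in all classes but the `k`-th
  obtain ⟨v, hvc, hK, hyv⟩ : ∃ v : Fin m → V, (∀ j, c (v j) = some (some j)) ∧
      IsMinusClique w u u' v ∧ ∀ j, j ≠ k → 1 ≤ w y (v j) := by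
    let A : Fin m → Finset V := fun j => (cls c (some (some j))).filter fun x =>
      (j ≠ k → 1 ≤ w y x) ∧ (2 ≤ w u x ∧ 2 ≤ w u' x)
    have hA : ∀ j, 2 * ∑ i, slack c η i < (A j).card := by
      intro j
      have h1 := card_le_card_filter_and (cls c (some (some j)))
        (fun x => j ≠ k → 1 ≤ w y x) (fun x => 2 ≤ w u x ∧ 2 ≤ w u' x)
      change _ ≤ (A j).card + _ + _ at h1
      have h2 : ((cls c (some (some j))).filter fun x => ¬ (2 ≤ w u x ∧ 2 ≤ w u' x)).card
          ≤ defect w u (Finset.univ \ Z) + defect w u' (Finset.univ \ Z) := by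
        simp only [not_and_or, Finset.filter_or]
        exact (Finset.card_union_le _ _).trans (Nat.add_le_add
          (card_filter_ne_two_le.trans (defect_mono (hWZ j)))
          (card_filter_ne_two_le.trans (defect_mono (hWZ j))))
      have h3 : 4 * ((cls c (some (some j))).filter fun x => ¬ (j ≠ k → 1 ≤ w y x)).card
          ≤ defect w y Finset.univ := by
        by_cases hjk : j = k
        · simp [hjk]
        · simp only [ne_eq, hjk, not_false_eq_true, forall_true_left]
          have h4 := defect_add_le (w := w) (x := y)
            (cls_disjoint c (a := some (some j)) (b := some (some k)) (by simpa using hjk))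
            (Finset.subset_univ _) (Finset.subset_univ _)
          have h5 := hk j (Finset.mem_univ j)
          have h6 : 2 * ((cls c (some (some j))).filter fun x => ¬ 1 ≤ w y x).card
            ≤ defect w y (cls c (some (some j))) := two_mul_card_filter_le
          omega
      have h4 : (4 * (cls c (some (some j))).card : ℝ) ≤ 4 * (A j).card
          + defect w y Finset.univ
          + 4 * (defect w u (Finset.univ \ Z) + defect w u' (Finset.univ \ Z)) := by
        exact_mod_cast (by omega : 4 * (cls c (some (some j))).card ≤ 4 * (A j).card
          + defect w y Finset.univ
          + 4 * (defect w u (Finset.univ \ Z) + defect w u' (Finset.univ \ Z)))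
      have h5 := hc.slack_le hw j
      have h6 := hcls j
      linarith
    obtain ⟨v, hvA, hv⟩ := hc.exists_transversal hw Finset.univ A
      (fun j _ => Finset.filter_subset _ _) fun j _ => hA j
    have hv' := fun j => Finset.mem_filter.1 (hvA j (Finset.mem_univ j))
    exact ⟨v, fun j => mem_cls.1 (hv' j).1,
      { red := fun i j => hv i (Finset.mem_univ i) j (Finset.mem_univ j)
        left := fun j => le_antisymm (hw.le_two _ _) (hv' j).2.2.1
        right := fun j => le_antisymm (hw.le_two _ _) (hv' j).2.2.2
        adj := huu }, fun j => (hv' j).2.1⟩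
  have hyu1 : 1 ≤ w u y := hw.symm y u ▸ hyu
  have hyu1' : 1 ≤ w u' y := hw.symm y u' ▸ hyu'
  -- `y` has few neighbours in the `k`-th class
  have hfew := hK.card_mul_lt hw (k := 3)
    (A := (cls c (some (some k))).filter fun x => 1 ≤ w y x) fun z hz => by
    obtain ⟨hzk, hyz⟩ := Finset.mem_filter.1 hz
    have hz0 : w z (v k) = 0 := hc.indep k z (v k) (mem_cls.1 hzk) (hvc k)
    refine hK.excess_ge_nine hw (fun h => ?_) fun j hj => ?_
    · have := h k; omega
    · by_cases hjk : j = k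
      · subst hjk
        have := hj.w_eq_zero hw hK hyv hyu1 hyu1'
        rw [hw.symm] at this
        omega
      · have := hj.red k (Ne.symm hjk); omega
  have hky : (defect w y (Finset.univ \ cls c (some (some k))) : ℝ)
      < 2 * slack c η k + 4 / 3 * η := by
    have h1 := defect_add_le (w := w) (x := y) (Finset.disjoint_sdiff
      (s := cls c (some (some k))) (t := Finset.univ)) (Finset.subset_univ _)
      (Finset.subset_univ _)
    have h2 : 2 * ((cls c (some (some k))).filter fun x => ¬ 1 ≤ w y x).card
      ≤ defect w y (cls c (some (some k))) := two_mul_card_filter_le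
    have h3 : ((cls c (some (some k))).filter fun x => 1 ≤ w y x).card
      + ((cls c (some (some k))).filter fun x => ¬ 1 ≤ w y x).card
      = (cls c (some (some k))).card := Finset.card_filter_add_card_filter_not _
    have h4 : (2 * (cls c (some (some k))).card
        + defect w y (Finset.univ \ cls c (some (some k))) : ℝ) ≤ defect w y Finset.univ
        + 2 * ((cls c (some (some k))).filter fun x => 1 ≤ w y x).card := by
      exact_mod_cast (by omega : 2 * (cls c (some (some k))).card
        + defect w y (Finset.univ \ cls c (some (some k))) ≤ defect w y Finset.univ
        + 2 * ((cls c (some (some k))).filter fun x => 1 ≤ w y x).card)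
    have h5 := hcls k
    push_cast at hfew
    linarith
  obtain ⟨x, hxk, hyx⟩ := hy k
  have hxη := hc.defect_compl_lt hw hxk
  -- a red transversal of all independent classes in the neighbourhood of `y`
  obtain ⟨t, htc, ht, hyt⟩ : ∃ t : Fin m → V, (∀ j, c (t j) = some (some j)) ∧
      IsRedClique w t ∧ ∀ j, 1 ≤ w y (t j) := by
    let A : Fin m → Finset V := fun j => (cls c (some (some j))).filter fun z =>
      1 ≤ w y z ∧ 2 ≤ w x z
    have hA : ∀ j ∈ Finset.univ.erase k, 2 * ∑ i, slack c η i < (A j).card := by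
      intro j hj
      have hjk := Finset.ne_of_mem_erase hj
      have hsub : cls c (some (some j)) ⊆ Finset.univ \ cls c (some (some k)) :=
        cls_subset_sdiff c (by simpa using hjk)
      have h1 := card_le_card_filter_and (cls c (some (some j)))
        (fun z => 1 ≤ w y z) (fun z => 2 ≤ w x z)
      change _ ≤ (A j).card + _ + _ at h1
      have h2 : ((cls c (some (some j))).filter fun z => ¬ 2 ≤ w x z).card
          ≤ defect w x (Finset.univ \ cls c (some (some k))) :=
        card_filter_ne_two_le.trans (defect_mono hsub)
      have h3 : 2 * ((cls c (some (some j))).filter fun z => ¬ 1 ≤ w y z).card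
          ≤ defect w y (Finset.univ \ cls c (some (some k))) :=
        two_mul_card_filter_le.trans (defect_mono hsub)
      have h4 : (2 * (cls c (some (some j))).card : ℝ) ≤ 2 * (A j).card
          + defect w y (Finset.univ \ cls c (some (some k)))
          + 2 * defect w x (Finset.univ \ cls c (some (some k))) := by
        exact_mod_cast (by omega : 2 * (cls c (some (some j))).card ≤ 2 * (A j).card
          + defect w y (Finset.univ \ cls c (some (some k)))
          + 2 * defect w x (Finset.univ \ cls c (some (some k))))
      have h5 := hc.slack_add_le hw hjk
      have h6 := hcls j
      have h7 := hc.slack_le hw k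
      linarith
    obtain ⟨t, htA, ht⟩ := hc.exists_transversal hw (Finset.univ.erase k) A
      (fun j _ => Finset.filter_subset _ _) hA
    have htA' : ∀ j, j ≠ k → t j ∈ A j := fun j hj =>
      htA j (Finset.mem_erase.2 ⟨hj, Finset.mem_univ j⟩)
    refine ⟨Function.update t k x, fun j => ?_, fun i j hij => ?_, forall_update
      (P := fun z => 1 ≤ w y z) hyx fun j hj => (Finset.mem_filter.1 (htA' j hj)).2.1⟩
    · by_cases hj : j = k
      · subst hj; rwa [Function.update_self]
      · rw [Function.update_of_ne hj]
        exact mem_cls.1 (Finset.mem_filter.1 (htA' j hj)).1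
    · have hxt : ∀ j, j ≠ k → w x (t j) = 2 := fun j hj =>
        le_antisymm (hw.le_two _ _) (Finset.mem_filter.1 (htA' j hj)).2.2
      by_cases hi : i = k
      · subst hi
        rw [Function.update_self, Function.update_of_ne hij.symm]
        exact hxt j hij.symm
      · rw [Function.update_of_ne hi]
        by_cases hj : j = k
        · subst hj
          rw [Function.update_self, hw.symm]
          exact hxt i hi
        · rw [Function.update_of_ne hj]
          exact ht i (by simpa using hi) j (by simpa using hj) hij
  let B := Z.filter fun z => 1 ≤ w y z ∧ ∀ j, 2 ≤ w (t j) z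
  have hB : 14 * η < Z.card + B.card := by
    have h1 := card_le_card_filter_and Z (fun z => 1 ≤ w y z) (fun z => ∀ j, 2 ≤ w (t j) z)
    have h2 : 2 * (Z.filter fun z => ¬ 1 ≤ w y z).card
        ≤ defect w y (Finset.univ \ cls c (some (some k))) :=
      two_mul_card_filter_le.trans (defect_mono (cls_subset_sdiff c (by simp)))
    have h3 : ((Z.filter fun z => ¬ ∀ j, 2 ≤ w (t j) z).card : ℝ) ≤ ∑ j, 2 * slack c η j := by
      have h4 : (Z.filter fun z => ¬ ∀ j, 2 ≤ w (t j) z)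
          ⊆ Finset.univ.biUnion fun j => Z.filter fun z => ¬ 2 ≤ w (t j) z := fun z hz => by
        obtain ⟨hzZ, hz⟩ := Finset.mem_filter.1 hz
        obtain ⟨j, hj⟩ := not_forall.1 hz
        exact Finset.mem_biUnion.2 ⟨j, Finset.mem_univ j, Finset.mem_filter.2 ⟨hzZ, hj⟩⟩
      have h5 : ((Z.filter fun z => ¬ ∀ j, 2 ≤ w (t j) z).card : ℝ)
          ≤ ∑ j, ((Z.filter fun z => ¬ 2 ≤ w (t j) z).card : ℝ) := by
        exact_mod_cast (Finset.card_le_card h4).trans Finset.card_biUnion_le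
      refine h5.trans (Finset.sum_le_sum fun j _ => le_trans ?_ (hc.defect_compl_lt hw (htc j)).le)
      exact_mod_cast card_filter_ne_two_le.trans (defect_mono (cls_subset_sdiff c (by simp)))
    rw [← Finset.mul_sum] at h3
    have h4 : (Z.card : ℝ) ≤ B.card + (Z.filter fun z => ¬ 1 ≤ w y z).card
        + (Z.filter fun z => ¬ ∀ j, 2 ≤ w (t j) z).card := by exact_mod_cast h1
    have h5 : (2 * (Z.filter fun z => ¬ 1 ≤ w y z).card : ℝ)
        ≤ defect w y (Finset.univ \ cls c (some (some k))) := by exact_mod_cast h2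
    have h6 := hc.slack_le hw k
    linarith
  have hBne : B.Nonempty := by
    rw [← Finset.card_pos, ← Nat.cast_pos (α := ℝ)]
    linarith
  obtain ⟨p, hp, q, hq, hpq⟩ := hc.exists_adj hw (Finset.filter_subset _ _) hBne hB.le
  have hp := (Finset.mem_filter.1 hp).2
  have hq := (Finset.mem_filter.1 hq).2
  have := hw.eq_zero ht (fun j => (hw.symm p (t j)).trans (le_antisymm (hw.le_two _ _) (hp.2 j)))
    (fun j => by rw [hw.symm]; have := hq.2 j; omega) hyt hpq (hw.symm y p ▸ hp.1)
  rw [hw.symm] at this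
  omega

/-- A dense `𝓕_{2m+4}`-free coloured graph containing `RK_{m+2}^-` has a full partition. -/
theorem IsMinusClique.exists_full_frame (hw : IsDense w m η) {u u' : V} {v : Fin m → V}
    (hK : IsMinusClique w u u' v) :
    ∃ c : V → Option (Option (Fin m)), IsFrame w c ∧ ∀ x, c x ≠ none := by
  classical
  obtain ⟨c₀, hc₀, he₀⟩ := hK.exists_frame hw
  obtain ⟨c, hc, hmin⟩ := Finset.exists_min_image
    (Finset.univ.filter fun c : V → Option (Option (Fin m)) => IsFrame w c)
    (fun c => (cls c none).card) ⟨c₀, by simpa using hc₀⟩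
  simp only [Finset.mem_filter, Finset.mem_univ, true_and] at hc hmin
  have he : 3 * ((cls c none).card : ℝ) < 2 * η := by
    have : ((cls c none).card : ℝ) ≤ (cls c₀ none).card := by exact_mod_cast hmin c₀ hc₀
    linarith
  refine ⟨c, hc, fun y hy => ?_⟩
  have hext : ∀ a, ¬ IsFrame w (Function.update c y (some a)) := fun a ha => by
    refine absurd (hmin _ ha) (not_le.2 (Finset.card_lt_card ?_))
    refine (Finset.ssubset_iff_of_subset fun x hx => ?_).2 ⟨y, mem_cls.2 hy, ?_⟩
    · rw [mem_cls] at hx ⊢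
      by_cases hxy : x = y
      · rw [hxy, hy]
      · rwa [Function.update_of_ne hxy] at hx
    · simp [mem_cls]
  -- membership in a class of the extended partition
  have hmem : ∀ {a b x}, Function.update c y (some a) x = some b →
      (x = y ∧ a = b) ∨ c x = some b := by
    intro a b x h
    by_cases hxy : x = y
    · subst hxy
      rw [Function.update_self, Option.some.injEq] at h
      exact Or.inl ⟨rfl, h⟩
    · rw [Function.update_of_ne hxy] at h
      exact Or.inr h
  have hnbr : ∀ j, ∃ x, c x = some (some j) ∧ 1 ≤ w y x := by
    intro j
    by_contra! h
    have h0 : ∀ x, c x = some (some j) → w y x = 0 := fun x hx => by have := h x hx; omega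
    refine hext (some j) ⟨fun i x z hx hz => ?_, fun x z hx hz => ?_, fun x z t hx hz ht => ?_⟩
    · rcases hmem hx with ⟨rfl, hj⟩ | hx' <;> rcases hmem hz with ⟨rfl, hj'⟩ | hz'
      · exact hw.diag _
      · exact h0 z (hj ▸ hz')
      · exact (hw.symm _ _).trans (h0 x (hj' ▸ hx'))
      · exact hc.indep i x z hx' hz'
    · have hx' := (hmem hx).resolve_left (by simp)
      have hz' := (hmem hz).resolve_left (by simp)
      exact hc.ne_two x z hx' hz'
    · have hx' := (hmem hx).resolve_left (by simp)
      have hz' := (hmem hz).resolve_left (by simp)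
      have ht' := (hmem ht).resolve_left (by simp)
      exact hc.eq_zero x z t hx' hz' ht'
  have hind : ∀ p q, c p = some none → c q = some none → 1 ≤ w y p → 1 ≤ w y q → w p q = 0 :=
    fun p q hp hq hyp hyq => hc.eq_zero_of_nbr hw he hnbr hp hq hyp hyq
  have hred : ∀ u, c u = some none → w y u ≠ 2 := fun u hu hyu => by
    obtain ⟨p, q, hp, hq, hyp, hyq, hpq⟩ := hc.exists_adj_of_red hw he hu hyu
    have := hind p q hp hq hyp hyq
    omega
  refine hext none ⟨fun i x z hx hz => ?_, fun x z hx hz => ?_,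
    fun x z t hx hz ht hxz hxt => ?_⟩
  · have hx' := (hmem hx).resolve_left (by simp)
    have hz' := (hmem hz).resolve_left (by simp)
    exact hc.indep i x z hx' hz'
  · rcases hmem hx with ⟨rfl, -⟩ | hx' <;> rcases hmem hz with ⟨rfl, -⟩ | hz'
    · rw [hw.diag]; norm_num
    · exact hred z hz'
    · rw [hw.symm]; exact hred x hx'
    · exact hc.ne_two x z hx' hz'
  · rcases hmem hx with ⟨rfl, -⟩ | hx' <;> rcases hmem hz with ⟨rfl, -⟩ | hz' <;>
      rcases hmem ht with ⟨rfl, -⟩ | ht'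
    · exact hw.diag _
    · rw [hw.diag] at hxz; omega
    · rw [hw.diag] at hxt; omega
    · exact hind z t hz' ht' hxz hxt
    · exact hw.diag _
    · by_contra hzt
      rw [hw.symm] at hxz
      have := hind x t hx' ht' hxz (by omega)
      omega
    · by_contra hzt
      rw [hw.symm] at hxt hzt
      have := hind x z hx' hz' hxt (by omega)
      omega
    · exact hc.eq_zero x z t hx' hz' ht' hxz hxt

/-- The class `Z` of a full partition induces a bipartite graph. -/
theorem IsFrame.exists_bipartition (hw : IsDense w m η) {c : V → Option (Option (Fin m))}
    (hc : IsFrame w c) (hfull : ∀ x, c x ≠ none) :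
    ∃ g : V → Fin 2, ∀ x y, c x = some none → c y = some none → g x = g y → w x y = 0 := by
  classical
  have hpos := hw.pos
  set Z := cls c (some none) with hZ
  have hmemZ : ∀ x : Z, c x = some none := fun x => mem_cls.1 x.2
  let H : SimpleGraph Z :=
    { Adj := fun x y => 1 ≤ w x y
      symm := ⟨fun x y h => by rw [hw.symm]; exact h⟩
      loopless := ⟨fun x h => by rw [hw.diag] at h; omega⟩ }
  have hfree : H.CliqueFree (2 + 1) := by
    intro s hs
    obtain ⟨a, b, d, hab, had, hbd, -⟩ := SimpleGraph.is3Clique_iff.1 hs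
    have hbd' : 1 ≤ w b d := hbd
    have := hc.eq_zero a b d (hmemZ a) (hmemZ b) (hmemZ d) hab had
    omega
  have hcard : Fintype.card Z = Z.card := Fintype.card_coe Z
  have hT := sum_slack hw c
  rw [← hZ, (Finset.card_eq_zero.2 (Finset.filter_eq_empty_iff.2 fun x _ => hfull x) :
    (cls c none).card = 0)] at hT
  have hT0 := Finset.sum_nonneg fun i (_ : i ∈ Finset.univ) => hc.slack_nonneg hw i
  rw [hT] at hT0
  have hZpos : 0 < Z.card := by
    rw [← Nat.cast_pos (α := ℝ)]
    push_cast at hT0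
    linarith
  have : Nonempty Z := (Finset.card_pos.1 hZpos).to_subtype
  have hdeg : (3 * 2 - 4) * Fintype.card Z / (3 * 2 - 1) < H.minDegree := by
    obtain ⟨x, hx⟩ := H.exists_minimal_degree_vertex
    rw [hx, hcard]
    have h1 : H.degree x = (Z.filter fun y => 1 ≤ w x y).card := by
      rw [← SimpleGraph.card_neighborFinset_eq_degree]
      refine Finset.card_bij (fun y _ => (y : V)) (fun y hy => ?_) (fun y _ z _ h => ?_)
        fun y hy => ?_
      · exact Finset.mem_filter.2 ⟨y.2, (H.mem_neighborFinset x y).1 hy⟩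
      · exact Subtype.ext h
      · obtain ⟨hyZ, hxy⟩ := Finset.mem_filter.1 hy
        exact ⟨⟨y, hyZ⟩, (H.mem_neighborFinset x _).2 hxy, rfl⟩
    have h2 : 2 * Z.card ≤ defect w x Z + (Z.filter fun y => 1 ≤ w x y).card := by
      rw [mul_comm, ← smul_eq_mul, ← Finset.sum_const, Finset.card_filter, defect,
        ← Finset.sum_add_distrib]
      refine Finset.sum_le_sum fun y hy => ?_
      have := hc.ne_two x y (hmemZ x) (mem_cls.1 hy)
      have := hw.le_two x y
      split_ifs <;> omega
    have h3 : (defect w x Z : ℝ) < 14 * η := lt_of_le_of_lt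
      (by exact_mod_cast defect_mono (Finset.subset_univ _)) (hw.defect_lt x)
    have h4 : (2 * Z.card : ℝ) ≤ defect w x Z + H.degree x := by rw [h1]; exact_mod_cast h2
    have h5 : (2 * Z.card : ℝ) < 5 * H.degree x := by
      push_cast at hT0
      linarith
    have h6 : 2 * Z.card < 5 * H.degree x := by exact_mod_cast h5
    omega
  obtain ⟨col⟩ := SimpleGraph.colorable_of_cliqueFree_lt_minDegree hfree hdeg
  refine ⟨fun x => if h : x ∈ Z then col ⟨x, h⟩ else 0, fun x y hx hy hxy => ?_⟩
  simp only [hZ, mem_cls, hx, hy, dif_pos] at hxy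
  by_contra hne
  exact col.valid (v := ⟨x, mem_cls.2 hx⟩) (w := ⟨y, mem_cls.2 hy⟩)
    (Nat.one_le_iff_ne_zero.2 hne) hxy

end IsDense

theorem IsColoured.isDense {V : Type*} [Fintype V] {w : V → V → ℕ} {m : ℕ} {η : ℝ}
    (hG : IsColoured w) (hfree : FamFree w (2 * (m + 2))) (hm : 1 ≤ m) (hpos : 0 < η)
    (hcard : (Fintype.card V : ℝ) = (7 * m + 9) * η)
    (hdeg : ∀ x, (defect w x Finset.univ : ℝ) < 14 * η) : IsDense w m η := by
  classical
  obtain ⟨hsymm, hle, hdiag⟩ := hG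
  have hle2 : ∀ {x y}, w x y = 2 → 2 ≤ w x y := fun h => h.ge
  have hle1 : ∀ {x y}, w x y = 2 → 1 ≤ w x y := fun h => by omega
  have hswap : ∀ {x y k}, k ≤ w x y → k ≤ w y x := fun {x y k} h => hsymm x y ▸ h
  have himg : ∀ {v : Fin m → V}, IsRedClique w v → (Finset.univ.image v).card = m := fun hv => by
    rw [Finset.card_image_of_injective _ (hv.injective hdiag), Finset.card_univ, Fintype.card_fin]
  have hnotMem : ∀ {v : Fin m → V} {x : V}, (∀ i, 1 ≤ w x (v i)) → x ∉ Finset.univ.image v := by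
    intro v x h hx
    obtain ⟨i, -, rfl⟩ := Finset.mem_image.1 hx
    have := h i
    rw [hdiag] at this
    omega
  have hne : ∀ {x y}, 1 ≤ w x y → x ≠ y := by
    rintro x _ h rfl
    rw [hdiag] at h
    omega
  have hinsert : ∀ {T : Finset V} {x : V} {k : ℕ},
      (∀ a ∈ T, ∀ b ∈ T, a ≠ b → k ≤ w a b) → (∀ a ∈ T, k ≤ w x a) →
      ∀ a ∈ insert x T, ∀ b ∈ insert x T, a ≠ b → k ≤ w a b := by
    intro T x k hT hx a ha b hb hab
    rw [Finset.mem_insert] at ha hb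
    rcases ha with rfl | ha <;> rcases hb with rfl | hb
    · exact absurd rfl hab
    · exact hx b hb
    · exact hswap (hx a ha)
    · exact hT a ha b hb hab
  have hforall : ∀ {v : Fin m → V} {x : V} {k : ℕ}, (∀ i, k ≤ w x (v i)) →
      ∀ a ∈ Finset.univ.image v, k ≤ w x a := by
    intro v x k h a ha
    obtain ⟨i, -, rfl⟩ := Finset.mem_image.1 ha
    exact h i
  have hbase : ∀ {v : Fin m → V}, IsRedClique w v → ∀ a ∈ Finset.univ.image v,
      ∀ b ∈ Finset.univ.image v, a ≠ b → 2 ≤ w a b := by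
    intro v hv a ha b hb hab
    obtain ⟨i, -, rfl⟩ := Finset.mem_image.1 ha
    obtain ⟨j, -, rfl⟩ := Finset.mem_image.1 hb
    exact hle2 (hv i j fun h => hab (h ▸ rfl))
  refine ⟨hsymm, hle, hdiag, fun {p q v} hv hp hq hpq => ?_,
    fun {p q s v} hv hp hq hs hpq hps => ?_, hm, hpos, hcard, hdeg⟩
  · set T := insert p (insert q (Finset.univ.image v)) with hT
    have hT2 : ∀ a ∈ T, ∀ b ∈ T, a ≠ b → 2 ≤ w a b :=
      hinsert (hinsert (hbase hv) (hforall fun i => hle2 (hq i))) fun a ha => by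
        rcases Finset.mem_insert.1 ha with rfl | ha
        · exact hle2 hpq
        · exact hforall (fun i => hle2 (hp i)) a ha
    have hcardT : T.card = m + 2 := by
      rw [hT, Finset.card_insert_of_notMem, Finset.card_insert_of_notMem, himg hv]
      · exact hnotMem fun i => hle1 (hq i)
      · rw [Finset.mem_insert, not_or]
        exact ⟨hne (hle1 hpq), hnotMem fun i => hle1 (hp i)⟩
    have : T.card + T.card < 2 * (m + 2) := hfree.card_add_card_lt (by omega) subset_rfl
      (Finset.insert_nonempty _ _) (fun a ha b hb hab => (hT2 a ha b hb hab).trans' (by norm_num))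
      hT2
    omega
  · by_contra hqs
    replace hqs : 1 ≤ w q s := Nat.one_le_iff_ne_zero.2 hqs
    set T := insert p (Finset.univ.image v) with hT
    have hT2 : ∀ a ∈ T, ∀ b ∈ T, a ≠ b → 2 ≤ w a b :=
      hinsert (hbase hv) (hforall fun i => hle2 (hp i))
    have hcardT : T.card = m + 1 := by
      rw [hT, Finset.card_insert_of_notMem (hnotMem fun i => hle1 (hp i)), himg hv]
    set S := insert q (insert s T) with hS
    have hsT : ∀ a ∈ T, 1 ≤ w s a := fun a ha => by
      rcases Finset.mem_insert.1 ha with rfl | ha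
      · exact hswap hps
      · exact hforall hs a ha
    have hqT : ∀ a ∈ insert s T, 1 ≤ w q a := fun a ha => by
      rcases Finset.mem_insert.1 ha with rfl | ha
      · exact hqs
      rcases Finset.mem_insert.1 ha with rfl | ha
      · exact hswap hpq
      · exact hforall hq a ha
    have hS1 : ∀ a ∈ S, ∀ b ∈ S, a ≠ b → 1 ≤ w a b :=
      hinsert (hinsert (fun a ha b hb hab => (hT2 a ha b hb hab).trans' (by norm_num)) hsT) hqT
    have hself : ∀ {x} {A : Finset V}, (∀ a ∈ A, 1 ≤ w x a) → x ∉ A := fun h hx =>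
      hne (h _ hx) rfl
    have hcardS : S.card = m + 3 := by
      rw [hS, Finset.card_insert_of_notMem (hself hqT), Finset.card_insert_of_notMem (hself hsT),
        hcardT]
    have : S.card + T.card < 2 * (m + 2) := hfree.card_add_card_lt (by omega)
      ((Finset.subset_insert _ _).trans (Finset.subset_insert _ _)) (Finset.insert_nonempty _ _)
      hS1 hT2
    omega

/-- Theorem (even case): an `𝓕_{2r}`-free coloured graph with minimum degree greater
than `((14r-24)/(7r-5))·n` admits a homomorphism to `RK_r^-`, i.e. a partition into `r`
classes all of whose internal edges have weight `0` and such that all edges between two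
distinguished classes have weight at most `1`. -/
theorem even_main {V : Type*} [Fintype V] (r : ℕ) (hr : 3 ≤ r)
    (w : V → V → ℕ) (hG : IsColoured w) (hfree : FamFree w (2 * r))
    (hdeg : ∀ x : V,
      (14 * (r : ℝ) - 24) / (7 * (r : ℝ) - 5) * (Fintype.card V : ℝ) < ∑ y : V, (w x y : ℝ)) :
    ∃ (f : V → Fin r) (i j : Fin r), i ≠ j ∧
      (∀ x y : V, x ≠ y → f x = f y → w x y = 0) ∧
      (∀ x y : V, f x = i → f y = j → w x y ≤ 1) := by
  classical
  obtain ⟨m, rfl⟩ : ∃ m, r = m + 2 := ⟨r - 2, by omega⟩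
  rcases isEmpty_or_nonempty V with hV | hV
  · exact ⟨hV.elim, 0, 1, by simp, hV.elim, hV.elim⟩
  have hm : (0 : ℝ) < 7 * m + 9 := by positivity
  have hn : (0 : ℝ) < Fintype.card V := by exact_mod_cast Fintype.card_pos
  obtain ⟨η, hη⟩ : ∃ η : ℝ, η = Fintype.card V / (7 * m + 9) := ⟨_, rfl⟩
  have hcard : (Fintype.card V : ℝ) = (7 * m + 9) * η := by rw [hη]; field_simp
  have hdeg' : ∀ x, ∑ y, (2 - w x y : ℝ) < 14 * η := by
    intro x
    have h1 : (14 * ((m + 2 : ℕ) : ℝ) - 24) / (7 * ((m + 2 : ℕ) : ℝ) - 5) * (Fintype.card V : ℝ)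
        = 2 * Fintype.card V - 14 * η := by
      rw [hη]
      push_cast
      rw [show 7 * ((m : ℝ) + 2) - 5 = 7 * m + 9 by ring]
      field_simp
      ring
    have h2 := hdeg x
    rw [h1] at h2
    rw [Finset.sum_sub_distrib, Finset.sum_const, Finset.card_univ, nsmul_eq_mul]
    linarith
  have hcast : ∀ x, (defect w x Finset.univ : ℝ) = ∑ y, (2 - w x y : ℝ) := fun x => by
    rw [defect, Nat.cast_sum]
    exact Finset.sum_congr rfl fun y _ => by rw [Nat.cast_sub (hG.2.1 x y), Nat.cast_ofNat]
  have hw : IsDense w m η := hG.isDense hfree (by omega) (hη ▸ div_pos hn hm) hcard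
    fun x => (hcast x).trans_lt (hdeg' x)
  obtain ⟨u, u', v, hv, hu, hu', huu⟩ := exists_red_clique_join_edge hG hfree hcard hdeg'
  have hK : IsMinusClique w u u' v := ⟨hv, hu, hu', huu⟩
  obtain ⟨c, hc, hfull⟩ := hK.exists_full_frame hw
  obtain ⟨g, hg⟩ := hc.exists_bipartition hw hfull
  let e : Fin 2 ⊕ Fin m → Fin (m + 2) := fun s => Fin.cast (Nat.add_comm 2 m) (finSumFinEquiv s)
  have he : Function.Injective e := (Fin.cast_injective _).comp finSumFinEquiv.injective
  let f : V → Fin 2 ⊕ Fin m := fun x =>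
    (c x).elim (Sum.inl 0) fun a => a.elim (Sum.inl (g x)) Sum.inr
  have hfZ : ∀ x i, f x = Sum.inl i → c x = some none ∧ g x = i := by
    intro x i h
    match hcx : c x with
    | none => exact absurd hcx (hfull x)
    | some none => simpa [f, hcx] using h
    | some (some j) => simp [f, hcx] at h
  have hfW : ∀ x j, f x = Sum.inr j → c x = some (some j) := by
    intro x j h
    match hcx : c x with
    | none => exact absurd hcx (hfull x)
    | some none => simp [f, hcx] at h
    | some (some i) => simpa [f, hcx] using h
  refine ⟨e ∘ f, e (Sum.inl 0), e (Sum.inl 1), he.ne (by simp), fun x y _ hxy => ?_,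
    fun x y hx hy => ?_⟩
  · replace hxy := he hxy
    match hfx : f x with
    | Sum.inl i =>
      obtain ⟨hx1, hx2⟩ := hfZ x i hfx
      obtain ⟨hy1, hy2⟩ := hfZ y i (hxy ▸ hfx)
      exact hg x y hx1 hy1 (hx2.trans hy2.symm)
    | Sum.inr j => exact hc.indep j x y (hfW x j hfx) (hfW y j (hxy ▸ hfx))
  · have h1 := hc.ne_two x y (hfZ x 0 (he hx)).1 (hfZ y 1 (he hy)).1
    have h2 := hw.le_two x y
    omega
end
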